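/- arXiv:2311.03341 — 5 statements merged into one kernel-verified Lean document; each statement's English description precedes it below -/
import Mathlib

section
/- Let H be a bipartite graph and let e = uv be an edge of H. Suppose there exist constants 0 < ε ≤ 1/2 and c > 1 such that for every integer s ≥ 1 and every n, every n-vertex graph with no K_{s,s} subgraph and no induced subgraph isomorphic to H has at most c·s^4·n^{2−ε} edges. Then there exist constants 0 < ε' ≤ 1/2 and c' > 1 such that for every integer s ≥ 1 and every n, every n-vertex graph with no K_{s,s} subgraph and no induced subgraph isomorphic to H − e (the graph obtained from H by deleting the edge e, keeping both endpoints) has at most c'·s^4·n^{2−ε'} edges. -/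
open SimpleGraph

/-- `G` contains a copy of `H` as a (not necessarily induced) subgraph. -/
def HasSubgraphCopy {V W : Type} (G : SimpleGraph V) (H : SimpleGraph W) : Prop :=
  ∃ f : H →g G, Function.Injective f

/-- `G` contains an induced copy of `H`. -/
def HasInducedCopy {V W : Type} (G : SimpleGraph V) (H : SimpleGraph W) : Prop :=
  ∃ s : Set V, Nonempty ((G.induce s) ≃g H)

/-- The graph obtained from `G` by subdividing the edge `ab` once (`none` is the new vertex). -/
def edgeSubdiv {V : Type} (G : SimpleGraph V) (a b : V) : SimpleGraph (Option V) :=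
  SimpleGraph.fromRel (fun x y =>
    (∃ x' y' : V, x = some x' ∧ y = some y' ∧ G.Adj x' y' ∧
      ¬((x' = a ∧ y' = b) ∨ (x' = b ∧ y' = a))) ∨
    (x = none ∧ (y = some a ∨ y = some b)))

/-- `IsSubdivision H S` : `S` is obtained from `H` by a finite sequence of single edge
subdivisions (edges of `H` get replaced by possibly longer paths). -/
inductive IsSubdivision : {V : Type} → SimpleGraph V → {W : Type} → SimpleGraph W → Prop
  | refl {V : Type} (G : SimpleGraph V) : IsSubdivision G G
  | step {V W : Type} (G : SimpleGraph V) (H : SimpleGraph W) (a b : W) :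
      IsSubdivision G H → H.Adj a b → IsSubdivision G (edgeSubdiv H a b)

/-- `G` contains an induced subdivision of `H`, i.e. some induced subgraph of `G` is
isomorphic to a subdivision of `H`. -/
def HasInducedSubdivision {V W : Type} (G : SimpleGraph V) (H : SimpleGraph W) : Prop :=
  ∃ (U : Type) (S : SimpleGraph U), IsSubdivision H S ∧ HasInducedCopy G S

/-- The average degree `2e(G)/|V(G)|` of a finite graph. -/
noncomputable def avgDeg {V : Type} (G : SimpleGraph V) [Fintype V] : ℝ :=
  2 * G.edgeSet.ncard / Fintype.card V

/-- `ExtremalBound H ε c` : for every integer `s ≥ 1`, every finite graph on a positive number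
`n` of vertices with no `K_{s,s}` subgraph and no induced copy of `H` has at most
`c·s⁴·n^(2-ε)` edges. -/
def ExtremalBound {VH : Type} (H : SimpleGraph VH) (ε c : ℝ) : Prop :=
  ∀ s : ℕ, 1 ≤ s → ∀ (V : Type) [Fintype V], ∀ G : SimpleGraph V,
    0 < Fintype.card V →
    ¬ HasSubgraphCopy G (completeBipartiteGraph (Fin s) (Fin s)) →
    ¬ HasInducedCopy G H →
    (G.edgeSet.ncard : ℝ) ≤ c * (s : ℝ) ^ 4 * (Fintype.card V : ℝ) ^ ((2 : ℝ) - ε)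

section Helpers
open Classical

theorem choose_mul_pow_le (n m : ℕ) (hmn : m ≤ n) : ∀ h : ℕ, h ≤ m →
    (n - h).choose (m - h) * n ^ h ≤ n.choose m * m ^ h := by
  intro h
  induction h with
  | zero => intro _; simp
  | succ h ih =>
    intro hh
    have ih := ih (by omega)
    obtain ⟨a, ha⟩ : ∃ a, m = h + 1 + a := ⟨m - (h + 1), by omega⟩
    obtain ⟨b, hb⟩ : ∃ b, n = h + 1 + b := ⟨n - (h + 1), by omega⟩
    have e1 : m - (h + 1) = a := by omega
    have e2 : n - (h + 1) = b := by omega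
    have e3 : m - h = a + 1 := by omega
    have e4 : n - h = b + 1 := by omega
    rw [e3, e4] at ih
    rw [e1, e2]
    have key := Nat.add_one_mul_choose_eq b a
    have hab : a ≤ b := by omega
    have cross : (a + 1) * n ≤ m * (b + 1) := by
      rw [ha, hb]; nlinarith
    have hpos : 0 < b + 1 := by omega
    refine le_of_mul_le_mul_left ?_ hpos
    calc (b + 1) * (b.choose a * n ^ (h + 1))
        = ((b + 1) * b.choose a) * n ^ h * n := by ring
      _ = ((b + 1).choose (a + 1) * n ^ h) * ((a + 1) * n) := by rw [key]; ring
      _ ≤ (n.choose m * m ^ h) * (m * (b + 1)) := Nat.mul_le_mul ih cross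
      _ = _ := by ring

theorem choose_two_lower (n m : ℕ) (hmn : m ≤ n) (hm : 2 ≤ m) :
    n.choose m * m ^ 2 ≤ 2 * ((n - 2).choose (m - 2) * n ^ 2) := by
  obtain ⟨a, rfl⟩ : ∃ a, m = a + 2 := ⟨m - 2, by omega⟩
  obtain ⟨b, rfl⟩ : ∃ b, n = b + 2 := ⟨n - 2, by omega⟩
  simp only [Nat.add_sub_cancel]
  have k1 := Nat.add_one_mul_choose_eq b a
  have k2 := Nat.add_one_mul_choose_eq (b + 1) (a + 1)
  have k3 : (b + 2).choose (a + 2) * ((a + 2) * (a + 1)) = b.choose a * ((b + 2) * (b + 1)) := by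
    calc (b + 2).choose (a + 2) * ((a + 2) * (a + 1))
        = ((b + 1 + 1).choose (a + 1 + 1) * (a + 1 + 1)) * (a + 1) := by ring_nf
      _ = (b + 2) * ((b + 1).choose (a + 1) * (a + 1)) := by rw [← k2]; ring
      _ = _ := by rw [← k1]; ring
  calc (b + 2).choose (a + 2) * (a + 2) ^ 2
      ≤ (b + 2).choose (a + 2) * (2 * ((a + 2) * (a + 1))) :=
        Nat.mul_le_mul_left _ (by nlinarith)
    _ = 2 * (b.choose a * ((b + 2) * (b + 1))) := by rw [← k3]; ring
    _ ≤ _ := by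
      refine Nat.mul_le_mul_left _ (Nat.mul_le_mul_left _ (by nlinarith))

/-- The induced embeddings of `H` in `G`. -/
noncomputable def embs {VH V : Type} [Fintype VH] [Fintype V]
    (H : SimpleGraph VH) (G : SimpleGraph V) : Finset (VH → V) :=
  Finset.univ.filter (fun f => Function.Injective f ∧ ∀ a b, G.Adj (f a) (f b) ↔ H.Adj a b)

theorem hasInducedCopy_of {VH V : Type} (H : SimpleGraph VH) (G : SimpleGraph V) (f : VH → V)
    (hf : Function.Injective f) (h : ∀ a b, G.Adj (f a) (f b) ↔ H.Adj a b) :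
    HasInducedCopy G H := by
  let φ : H ↪g G := ⟨⟨f, hf⟩, by intro a b; exact h a b⟩
  exact ⟨Set.range φ, ⟨(SimpleGraph.Embedding.isoInduceRange (f := φ)).symm⟩⟩

theorem exists_of_hasInducedCopy {VH V : Type} [Fintype VH] [Fintype V]
    (H : SimpleGraph VH) (G : SimpleGraph V) (S : Finset V)
    (h : HasInducedCopy (G.induce (S : Set V)) H) :
    ∃ f ∈ embs H G, Finset.univ.image f ⊆ S := by
  obtain ⟨T, ⟨φ⟩⟩ := h
  refine ⟨fun a => ((φ.symm a).1).1, ?_, ?_⟩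
  · simp only [embs, Finset.mem_filter, Finset.mem_univ, true_and]
    refine ⟨?_, ?_⟩
    · intro a b hab
      exact φ.symm.injective (Subtype.ext (Subtype.ext hab))
    · intro a b
      exact φ.symm.map_adj_iff (v := a) (w := b)
  · intro x hx
    simp only [Finset.mem_image, Finset.mem_univ, true_and] at hx
    obtain ⟨a, rfl⟩ := hx
    exact ((φ.symm a).1).2

theorem hasSubgraphCopy_of {V : Type} (G : SimpleGraph V) (s : ℕ) (X Y : Finset V)
    (hX : 2 * s ≤ X.card) (hY : 2 * s ≤ Y.card)
    (hXY : ∀ x ∈ X, ∀ y ∈ Y, x ≠ y → G.Adj x y) :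
    HasSubgraphCopy G (completeBipartiteGraph (Fin s) (Fin s)) := by
  obtain ⟨X', hX', cX⟩ := Finset.exists_subset_card_eq (show s ≤ X.card by omega)
  have : s ≤ (Y \ X').card := by
    have := Finset.le_card_sdiff X' Y
    omega
  obtain ⟨Y', hY', cY⟩ := Finset.exists_subset_card_eq this
  let eX := (X'.equivFinOfCardEq cX).symm
  let eY := (Y'.equivFinOfCardEq cY).symm
  have hne : ∀ i j, (eX i : V) ≠ eY j := by
    intro i j hij
    have h1 := hY' (eY j).2
    rw [← hij] at h1
    exact (Finset.mem_sdiff.1 h1).2 (eX i).2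
  have hadj : ∀ i j, G.Adj (eX i : V) (eY j) := fun i j =>
    hXY _ (hX' (eX i).2) _ (Finset.mem_sdiff.1 (hY' (eY j).2)).1 (hne i j)
  refine ⟨⟨Sum.elim (fun i => (eX i : V)) (fun j => (eY j : V)), ?_⟩, ?_⟩
  · rintro (a | a) (b | b) h
    · simp at h
    · exact hadj a b
    · exact (hadj b a).symm
    · simp at h
  · rintro (a | a) (b | b) h
    · exact congrArg _ (eX.injective (Subtype.ext h))
    · exact absurd h (hne a b)
    · exact absurd h.symm (hne b a)
    · exact congrArg _ (eY.injective (Subtype.ext h))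

theorem card_embs_le {VH V : Type} [Fintype VH] [Fintype V]
    (H : SimpleGraph VH) (G : SimpleGraph V) (u v : VH) (huv : H.Adj u v) (s : ℕ)
    (hK : ¬ HasSubgraphCopy G (completeBipartiteGraph (Fin s) (Fin s)))
    (hI : ¬ HasInducedCopy G (H.deleteEdges {s(u, v)})) :
    (embs H G).card ≤ 2 * s * Fintype.card V ^ (Fintype.card VH - 1) := by
  let R := {w : VH // w ≠ u ∧ w ≠ v}
  let r : (VH → V) → (R → V) := fun f w => f w.1
  have huv' : u ≠ v := huv.ne
  have hcardR : Fintype.card R + 2 = Fintype.card VH := by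
    have h1 : Fintype.card R = (Finset.univ \ {u, v} : Finset VH).card := by
      rw [Fintype.card_subtype]
      congr 1
      ext w; simp
    rw [h1, Finset.card_sdiff_of_subset (Finset.subset_univ _), Finset.card_pair huv']
    have := Finset.card_le_univ ({u, v} : Finset VH)
    rw [Finset.card_pair huv'] at this
    simp only [Finset.card_univ]; omega
  have fib : ∀ g : R → V, ((embs H G).filter (fun f => r f = g)).card
      ≤ 2 * s * Fintype.card V := by
    intro g
    set F := (embs H G).filter (fun f => r f = g) with hF
    have memF : ∀ f ∈ F, Function.Injective f ∧ (∀ a b, G.Adj (f a) (f b) ↔ H.Adj a b) ∧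
        ∀ w (hw : w ≠ u ∧ w ≠ v), f w = g ⟨w, hw⟩ := by
      intro f hf
      simp only [hF, embs, Finset.mem_filter, Finset.mem_univ, true_and] at hf
      exact ⟨hf.1.1, hf.1.2, fun w hw => congrFun hf.2 ⟨w, hw⟩⟩
    let X := F.image (fun f => f u)
    let Y := F.image (fun f => f v)
    have hXY : ∀ x ∈ X, ∀ y ∈ Y, x ≠ y → G.Adj x y := by
      intro x hx y hy hxy
      simp only [X, Y, Finset.mem_image] at hx hy
      obtain ⟨f, hf, rfl⟩ := hx
      obtain ⟨f', hf', rfl⟩ := hy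
      obtain ⟨i1, a1, g1⟩ := memF f hf
      obtain ⟨i2, a2, g2⟩ := memF f' hf'
      by_contra hna
      apply hI
      have hagree : ∀ w, w ≠ u → w ≠ v → f w = f' w := fun w h1 h2 => by
        rw [g1 w ⟨h1, h2⟩, g2 w ⟨h1, h2⟩]
      let k : VH → V := fun w => if w = v then f' v else f w
      have kv : k v = f' v := by simp [k]
      have ko : ∀ w, w ≠ v → k w = f w := fun w hw => by simp [k, hw]
      have hvne : ∀ w, w ≠ v → f w ≠ f' v := by
        intro w hw
        by_cases hwu : w = u
        · rw [hwu]; exact hxy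
        · rw [hagree w hwu hw]
          exact fun h => hw (i2 h)
      have hvadj : ∀ w, w ≠ v → (G.Adj (f w) (f' v) ↔ (H.deleteEdges {s(u, v)}).Adj w v) := by
        intro w hw
        by_cases hwu : w = u
        · subst hwu
          simp [hna]
        · rw [hagree w hwu hw, a2]
          simp [hw, hwu]
      refine hasInducedCopy_of _ _ k ?_ ?_
      · intro a b hab
        by_cases ha : a = v <;> by_cases hb : b = v
        · rw [ha, hb]
        · rw [ha, kv, ko b hb] at hab
          exact absurd hab.symm (hvne b hb)
        · rw [hb, kv, ko a ha] at hab
          exact absurd hab (hvne a ha)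
        · rw [ko a ha, ko b hb] at hab
          exact i1 hab
      · intro a b
        by_cases ha : a = v <;> by_cases hb : b = v
        · rw [ha, hb]; simp
        · rw [ha, kv, ko b hb, G.adj_comm, (H.deleteEdges {s(u, v)}).adj_comm]
          exact hvadj b hb
        · rw [hb, kv, ko a ha]
          exact hvadj a ha
        · rw [ko a ha, ko b hb, a1]
          simp [ha, hb]
    have hFc : F.card ≤ X.card * Y.card := by
      rw [← Finset.card_product]
      refine Finset.card_le_card_of_injOn (fun f => (f u, f v)) ?_ ?_
      · intro f hf
        exact Finset.mem_coe.2 (Finset.mem_product.2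
          ⟨Finset.mem_image_of_mem _ hf, Finset.mem_image_of_mem _ hf⟩)
      · intro f hf f' hf' h
        obtain ⟨_, _, g1⟩ := memF f hf
        obtain ⟨_, _, g2⟩ := memF f' hf'
        simp only [Prod.mk.injEq] at h
        funext w
        by_cases hwu : w = u
        · rw [hwu]; exact h.1
        by_cases hwv : w = v
        · rw [hwv]; exact h.2
        rw [g1 w ⟨hwu, hwv⟩, g2 w ⟨hwu, hwv⟩]
    have hXn : X.card ≤ Fintype.card V := Finset.card_le_univ X
    have hYn : Y.card ≤ Fintype.card V := Finset.card_le_univ Y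
    by_cases h1 : 2 * s ≤ X.card
    · by_cases h2 : 2 * s ≤ Y.card
      · exact absurd (hasSubgraphCopy_of G s X Y h1 h2 hXY) hK
      · calc F.card ≤ X.card * Y.card := hFc
          _ ≤ Fintype.card V * (2 * s) := Nat.mul_le_mul hXn (by omega)
          _ = _ := by ring
    · exact hFc.trans (Nat.mul_le_mul (by omega) hYn)
  have h1 := Finset.card_le_mul_card_image_of_maps_to (s := embs H G) (t := Finset.univ) (f := r)
    (fun _ _ => Finset.mem_univ _) (2 * s * Fintype.card V) (fun g _ => fib g)
  rw [Finset.card_univ, Fintype.card_fun] at h1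
  refine h1.trans (le_of_eq ?_)
  have : Fintype.card VH - 1 = Fintype.card R + 1 := by omega
  rw [this, pow_succ]; ring

theorem edges_induce {V : Type} [Fintype V] (G : SimpleGraph V) (S : Finset V) :
    (G.edgeFinset.filter (fun e => e.toFinset ⊆ S)).card ≤
      (G.induce (S : Set V)).edgeSet.ncard := by
  have h : ((G.edgeFinset.filter (fun e => e.toFinset ⊆ S) : Finset (Sym2 V)) : Set (Sym2 V)) ⊆
      (Sym2.map Subtype.val) '' (G.induce (S : Set V)).edgeSet := by
    intro e he
    induction e using Sym2.ind with
    | _ x y =>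
      simp only [Finset.coe_filter, SimpleGraph.mem_edgeFinset, SimpleGraph.mem_edgeSet,
        Set.mem_ofPred_eq] at he
      have hx : x ∈ S := he.2 (by simp)
      have hy : y ∈ S := he.2 (by simp)
      exact ⟨s(⟨x, hx⟩, ⟨y, hy⟩), by simpa using he.1, by simp⟩
  rw [← Set.ncard_coe_finset]
  exact (Set.ncard_le_ncard h (Set.toFinite _)).trans (Set.ncard_image_le (Set.toFinite _))

theorem main_ineq {VH V : Type} [Fintype VH] [Fintype V]
    (H : SimpleGraph VH) (G : SimpleGraph V) (u v : VH) (huv : H.Adj u v) (s m : ℕ) (hs : 1 ≤ s)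
    (ε c : ℝ) (hext : ExtremalBound H ε c)
    (hc : 0 ≤ c)
    (hK : ¬ HasSubgraphCopy G (completeBipartiteGraph (Fin s) (Fin s)))
    (hI : ¬ HasInducedCopy G (H.deleteEdges {s(u, v)}))
    (hm : 2 ≤ m) (hmn : m ≤ Fintype.card V) :
    (G.edgeSet.ncard : ℝ) ≤ 2 * c * (s : ℝ) ^ 4 * (Fintype.card V : ℝ) ^ 2 * (m : ℝ) ^ (-ε)
      + 4 * s * Fintype.card V * (m : ℝ) ^ (Fintype.card VH) := by
  set n := Fintype.card V with hn
  set h := Fintype.card VH with hh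
  set B : ℝ := c * (s : ℝ) ^ 4 * (m : ℝ) ^ ((2 : ℝ) - ε) with hB
  have hB0 : 0 ≤ B := by positivity
  have h1h : 1 ≤ h := Fintype.card_pos_iff.2 ⟨u⟩
  let P := Finset.powersetCard m (Finset.univ : Finset V)
  have hPc : P.card = n.choose m := by simp [P, hn]
  -- local inequality
  have loc : ∀ S ∈ P, ((G.edgeFinset.filter (fun e => e.toFinset ⊆ S)).card : ℝ) ≤
      B + (m : ℝ) ^ 2 * ((embs H G).filter (fun f => Finset.univ.image f ⊆ S)).card := by
    intro S hS
    have hSc : S.card = m := (Finset.mem_powersetCard.1 hS).2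
    have e1 : ((G.edgeFinset.filter (fun e => e.toFinset ⊆ S)).card : ℝ) ≤
      (G.induce (S : Set V)).edgeSet.ncard := by exact_mod_cast edges_induce G S
    have hcS : Fintype.card (S : Set V) = m := by simp [hSc]
    by_cases hcop : HasInducedCopy (G.induce (S : Set V)) H
    · obtain ⟨f, hf, hfS⟩ := exists_of_hasInducedCopy H G S hcop
      have hpos : 1 ≤ ((embs H G).filter (fun f => Finset.univ.image f ⊆ S)).card :=
        Finset.card_pos.2 ⟨f, Finset.mem_filter.2 ⟨hf, hfS⟩⟩
      have e2 : (G.induce (S : Set V)).edgeSet.ncard ≤ m ^ 2 := by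
        rw [← SimpleGraph.coe_edgeFinset, Set.ncard_coe_finset]
        refine (SimpleGraph.card_edgeFinset_le_card_choose_two (G := G.induce (S : Set V))).trans ?_
        rw [hcS]
        exact Nat.choose_le_pow m 2
      have e2' : ((G.induce (S : Set V)).edgeSet.ncard : ℝ) ≤ (m : ℝ) ^ 2 := by exact_mod_cast e2
      have hpos' : (1 : ℝ) ≤ ((embs H G).filter (fun f => Finset.univ.image f ⊆ S)).card := by
        exact_mod_cast hpos
      nlinarith [sq_nonneg (m : ℝ)]
    · have := hext s hs (S : Set V) (G.induce (S : Set V)) (by omega) ?_ hcop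
      · rw [hcS] at this
        have h0 : (0 : ℝ) ≤ (m : ℝ) ^ 2 *
          ((embs H G).filter (fun f => Finset.univ.image f ⊆ S)).card := by positivity
        linarith
      · rintro ⟨f, hf⟩
        apply hK
        refine ⟨⟨fun a => (f a).1, fun hab => f.map_adj hab⟩, ?_⟩
        intro a b hab
        exact hf (Subtype.ext hab)
  -- double counting
  have sumE : ∑ S ∈ P, (G.edgeFinset.filter (fun e => e.toFinset ⊆ S)).card =
      G.edgeSet.ncard * (n - 2).choose (m - 2) := by
    have h1 := Finset.sum_card_bipartiteAbove_eq_sum_card_bipartiteBelow (s := P)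
      (t := G.edgeFinset) (fun S e => e.toFinset ⊆ S)
    simp only [Finset.bipartiteAbove, Finset.bipartiteBelow] at h1
    rw [h1, Finset.sum_congr rfl (g := fun _ => (n - 2).choose (m - 2))]
    · rw [Finset.sum_const, smul_eq_mul, ← Set.ncard_coe_finset, SimpleGraph.coe_edgeFinset]
    · intro e he
      have he2 : e.toFinset.card = 2 := Sym2.card_toFinset_of_not_isDiag e
        (G.not_isDiag_of_mem_edgeSet (SimpleGraph.mem_edgeFinset.1 he))
      have := Finset.card_filter_powersetCard_subset (s := e.toFinset) (t := Finset.univ) (n := m)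
        (Finset.subset_univ _) (by omega)
      rw [he2, Finset.card_univ] at this
      exact this
  have sumF : (∑ S ∈ P, ((embs H G).filter (fun f => Finset.univ.image f ⊆ S)).card) * n ^ h ≤
      (embs H G).card * (n.choose m * m ^ h) := by
    have h1 := Finset.sum_card_bipartiteAbove_eq_sum_card_bipartiteBelow (s := P)
      (t := embs H G) (fun S f => Finset.univ.image f ⊆ S)
    simp only [Finset.bipartiteAbove, Finset.bipartiteBelow] at h1
    rw [h1, Finset.sum_mul, ← smul_eq_mul (embs H G).card]
    refine Finset.sum_le_card_nsmul _ _ _ ?_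
    intro f hf
    have hinj : Function.Injective f := by
      simp only [embs, Finset.mem_filter] at hf
      exact hf.2.1
    have hfc : (Finset.univ.image f).card = h := by
      rw [Finset.card_image_of_injective _ hinj, Finset.card_univ]
    by_cases hhm : h ≤ m
    · have := Finset.card_filter_powersetCard_subset (s := Finset.univ.image f) (t := Finset.univ) (n := m)
        (Finset.subset_univ _) (by omega)
      rw [hfc, Finset.card_univ] at this
      rw [this]
      exact choose_mul_pow_le n m hmn h hhm
    · rw [Finset.card_eq_zero.2, zero_mul]
      · exact Nat.zero_le _
      · rw [Finset.filter_eq_empty_iff]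
        intro S hS hsub
        have h2 := Finset.card_le_card hsub
        rw [hfc, (Finset.mem_powersetCard.1 hS).2] at h2
        exact hhm h2
  clear_value B
  have tot := Finset.sum_le_sum loc
  rw [Finset.sum_add_distrib, ← Finset.mul_sum, Finset.sum_const, hPc] at tot
  have sumE' : ∑ S ∈ P, ((G.edgeFinset.filter (fun e => e.toFinset ⊆ S)).card : ℝ) =
      G.edgeSet.ncard * ((n - 2).choose (m - 2) : ℕ) := by exact_mod_cast sumE
  have sumF' : (∑ S ∈ P, (((embs H G).filter (fun f => Finset.univ.image f ⊆ S)).card : ℝ)) *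
      (n : ℝ) ^ h ≤ (embs H G).card * ((n.choose m : ℕ) * (m : ℝ) ^ h) := by exact_mod_cast sumF
  rw [sumE'] at tot
  set Fs := ∑ S ∈ P, (((embs H G).filter (fun f => Finset.univ.image f ⊆ S)).card : ℝ) with hFs
  have hemb : ((embs H G).card : ℝ) ≤ 2 * s * (n : ℝ) ^ (h - 1) := by
    exact_mod_cast card_embs_le H G u v huv s hK hI
  have c2 : ((n.choose m : ℕ) : ℝ) * (m : ℝ) ^ 2 ≤ 2 * (((n - 2).choose (m - 2) : ℕ) * (n : ℝ) ^ 2) := by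
    exact_mod_cast choose_two_lower n m hmn hm
  set N : ℝ := ((n.choose m : ℕ) : ℝ) with hN
  set N2 : ℝ := (((n - 2).choose (m - 2) : ℕ) : ℝ) with hN2
  set E : ℝ := (G.edgeSet.ncard : ℝ) with hE
  have hE0 : 0 ≤ E := by positivity
  have hNpos : 0 < N := by
    have := Nat.choose_pos hmn
    rw [hN]; exact_mod_cast this
  have hmpos : (0 : ℝ) < m := by exact_mod_cast (by omega : 0 < m)
  have hnpos : (0 : ℝ) < n := by exact_mod_cast (by omega : 0 < n)
  have hnh : (n : ℝ) ^ h = (n : ℝ) ^ (h - 1) * n := by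
    rw [← pow_succ]; congr 1; omega
  have hFs2 : Fs * n ≤ 2 * s * (N * (m : ℝ) ^ h) := by
    have hp : (0 : ℝ) < (n : ℝ) ^ (h - 1) := by positivity
    have h3 : Fs * (n : ℝ) ^ h ≤ 2 * s * (n : ℝ) ^ (h - 1) * (N * (m : ℝ) ^ h) :=
      sumF'.trans (mul_le_mul_of_nonneg_right hemb (by positivity))
    rw [hnh] at h3
    refine le_of_mul_le_mul_left ?_ hp
    linarith
  have hBm : B = c * (s : ℝ) ^ 4 * ((m : ℝ) ^ (-ε) * (m : ℝ) ^ 2) := by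
    rw [hB, show (2 : ℝ) - ε = -ε + (2 : ℕ) by push_cast; ring, Real.rpow_add hmpos,
      Real.rpow_natCast]
  have fin : (N * (m : ℝ) ^ 2) * E ≤ (N * (m : ℝ) ^ 2) *
      (2 * c * (s : ℝ) ^ 4 * (n : ℝ) ^ 2 * (m : ℝ) ^ (-ε) + 4 * s * n * (m : ℝ) ^ h) := by
    calc (N * (m : ℝ) ^ 2) * E ≤ 2 * (N2 * (n : ℝ) ^ 2) * E :=
          mul_le_mul_of_nonneg_right c2 hE0
      _ = 2 * (n : ℝ) ^ 2 * (E * N2) := by ring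
      _ ≤ 2 * (n : ℝ) ^ 2 * (n.choose m • B + (m : ℝ) ^ 2 * Fs) :=
          mul_le_mul_of_nonneg_left tot (by positivity)
      _ = 2 * (n : ℝ) ^ 2 * (N * B) + 2 * n * (m : ℝ) ^ 2 * (Fs * n) := by
          rw [nsmul_eq_mul]; ring
      _ ≤ 2 * (n : ℝ) ^ 2 * (N * B) + 2 * n * (m : ℝ) ^ 2 * (2 * s * (N * (m : ℝ) ^ h)) := by
          gcongr
      _ = _ := by rw [hBm]; ring
  exact le_of_mul_le_mul_left fin (by positivity)

end Helpers

/-- If the induced Turán-type bound holds for a bipartite graph `H` with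
constants `ε, c`, and `e = uv` is an edge of `H`, then it also holds for `H - e` with some
constants `ε', c'`. -/
theorem stmt_5 {VH : Type} [Fintype VH] (H : SimpleGraph VH) (hH : H.Colorable 2)
    (u v : VH) (huv : H.Adj u v)
    (ε c : ℝ) (hε : 0 < ε) (hε2 : ε ≤ 1 / 2) (hc : 1 < c) (hext : ExtremalBound H ε c) :
    ∃ ε' c' : ℝ, 0 < ε' ∧ ε' ≤ 1 / 2 ∧ 1 < c' ∧
      ExtremalBound (H.deleteEdges {s(u, v)}) ε' c' := by
  have hcard : 2 ≤ Fintype.card VH := by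
    have := Fintype.one_lt_card_iff.2 ⟨u, v, huv.ne⟩
    omega
  set h := Fintype.card VH with hh
  have hR : (2 : ℝ) ≤ h := by exact_mod_cast hcard
  refine ⟨ε / (2 * h), 2 * c + 4 * 2 ^ h, by positivity, ?_, ?_, ?_⟩
  · rw [div_le_iff₀ (by positivity)]; nlinarith
  · have : (0 : ℝ) < 4 * 2 ^ h := by positivity
    linarith
  intro s hs V _ G hV hK hI
  set n := Fintype.card V with hn
  have hnR : (1 : ℝ) ≤ n := by exact_mod_cast hV
  have hsR : (1 : ℝ) ≤ s := by exact_mod_cast hs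
  rcases Nat.lt_or_ge n 2 with hlt | hge
  · have hsub : Subsingleton V := Fintype.card_le_one_iff_subsingleton.1 (by omega)
    have : G.edgeSet = ∅ := by
      rw [SimpleGraph.edgeSet_eq_empty]
      exact Subsingleton.elim _ _
    rw [this, Set.ncard_empty, Nat.cast_zero]
    have : 0 < c := by linarith
    positivity
  have hnR2 : (1 : ℝ) < n := by exact_mod_cast hge
  set t : ℝ := (n : ℝ) ^ (1 / (2 * h : ℝ)) with ht
  have ht1 : 1 < t := Real.one_lt_rpow hnR2 (by positivity)
  have htn : t ≤ n := by
    calc t ≤ (n : ℝ) ^ (1 : ℝ) := Real.rpow_le_rpow_of_exponent_le hnR (by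
          rw [div_le_one (by positivity)]; linarith)
      _ = n := Real.rpow_one _
  set m := ⌈t⌉₊ with hm
  have htm : t ≤ m := Nat.le_ceil t
  have hm2 : 2 ≤ m := by
    have : (1 : ℝ) < m := lt_of_lt_of_le ht1 htm
    exact_mod_cast this
  have hmn : m ≤ n := Nat.ceil_le.2 htn
  have hmt : (m : ℝ) ≤ 2 * t := by
    have := Nat.ceil_lt_add_one (show 0 ≤ t by linarith)
    linarith
  have key := main_ineq H G u v huv s m hs ε c hext (by linarith) hK hI hm2 hmn
  rw [← hn, ← hh] at key
  have hn0 : (0 : ℝ) < n := by linarith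
  have p1 : (m : ℝ) ^ (-ε) ≤ (n : ℝ) ^ (-(ε / (2 * h))) := by
    calc (m : ℝ) ^ (-ε) ≤ t ^ (-ε) :=
          Real.rpow_le_rpow_of_nonpos (by linarith) htm (by linarith)
      _ = _ := by
        rw [ht, ← Real.rpow_mul hn0.le]; congr 1; ring
  have p2 : (m : ℝ) ^ h ≤ 2 ^ h * (n : ℝ) ^ (1 / 2 : ℝ) := by
    calc (m : ℝ) ^ h ≤ (2 * t) ^ h := pow_le_pow_left₀ (by positivity) hmt h
      _ = 2 ^ h * t ^ h := mul_pow _ _ _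
      _ = _ := by
        rw [ht, ← Real.rpow_natCast ((n : ℝ) ^ (1 / (2 * h : ℝ))), ← Real.rpow_mul hn0.le]
        congr 2; field_simp
  have q1 : (n : ℝ) ^ 2 * (n : ℝ) ^ (-(ε / (2 * h))) = (n : ℝ) ^ (2 - ε / (2 * h)) := by
    rw [← Real.rpow_natCast, ← Real.rpow_add hn0]; norm_num [sub_eq_add_neg]
  have q2 : (n : ℝ) * (n : ℝ) ^ (1 / 2 : ℝ) ≤ (n : ℝ) ^ (2 - ε / (2 * h)) := by
    nth_rewrite 1 [← Real.rpow_one (n : ℝ)]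
    rw [← Real.rpow_add hn0]
    refine Real.rpow_le_rpow_of_exponent_le hnR ?_
    have : ε / (2 * h) ≤ 1 / 2 := by
      rw [div_le_iff₀ (by positivity)]; nlinarith
    linarith
  have hs4 : (s : ℝ) ≤ (s : ℝ) ^ 4 := le_self_pow₀ hsR (by norm_num)
  have hc0 : 0 < c := by linarith
  calc (G.edgeSet.ncard : ℝ) ≤ _ := key
    _ ≤ 2 * c * (s : ℝ) ^ 4 * (n : ℝ) ^ 2 * (n : ℝ) ^ (-(ε / (2 * h)))
        + 4 * (s : ℝ) ^ 4 * n * (2 ^ h * (n : ℝ) ^ (1 / 2 : ℝ)) := by gcongr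
    _ = 2 * c * (s : ℝ) ^ 4 * ((n : ℝ) ^ 2 * (n : ℝ) ^ (-(ε / (2 * h))))
        + 4 * (s : ℝ) ^ 4 * 2 ^ h * (n * (n : ℝ) ^ (1 / 2 : ℝ)) := by ring
    _ ≤ 2 * c * (s : ℝ) ^ 4 * (n : ℝ) ^ (2 - ε / (2 * h))
        + 4 * (s : ℝ) ^ 4 * 2 ^ h * (n : ℝ) ^ (2 - ε / (2 * h)) := by
        rw [q1]; gcongr
    _ = _ := by ring
end

section
/- Let H be a bipartite graph with |V(H)| ≥ 2 and let 0 < ε ≤ 1/2 and c > 1 be constants such that for every integer s ≥ 1 and every n, every n-vertex graph with no K_{s,s} subgraph and no induced subgraph isomorphic to H has at most c·s^4·n^{2−ε} edges. Set ε' = ε/(2|V(H)|) and c' = max{|V(H)|, c}. Let s ≥ 2 be an integer and let G be an n-vertex graph with e(G) > c'·s^4·n^{2−ε'}. Let m be an integer satisfying (n/(4s))^{1/|V(H)|} ≤ m ≤ √n. If U is a subset of m vertices of G chosen uniformly at random, then the probability that G[U] has more than c·s^4·m^{2−ε} edges is at least 3/4. -/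
open SimpleGraph

lemma aux_card_sup {V : Type} [Fintype V] [DecidableEq V] (A : Finset V) (m : ℕ)
    (hA : A.card ≤ m) :
    ((Finset.univ.powersetCard m).filter (fun U : Finset V => A ⊆ U)).card
      = (Fintype.card V - A.card).choose (m - A.card) := by
  have : (Fintype.card V - A.card).choose (m - A.card) = (Aᶜ.powersetCard (m - A.card)).card := by
    rw [Finset.card_powersetCard, Finset.card_compl]
  rw [this]
  refine Finset.card_bij' (fun U _ => U \ A) (fun U _ => U ∪ A) ?_ ?_ ?_ ?_
  · intro U hU
    simp only [Finset.mem_filter, Finset.mem_powersetCard] at hU ⊢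
    refine ⟨?_, ?_⟩
    · intro x; simp
    · rw [Finset.card_sdiff_of_subset hU.2, hU.1.2]
  · intro U hU
    simp only [Finset.mem_filter, Finset.mem_powersetCard] at hU ⊢
    refine ⟨⟨Finset.subset_univ _, ?_⟩, Finset.subset_union_right⟩
    have hd : Disjoint U A := by
      rw [Finset.disjoint_left]; intro x hx hxA
      have := hU.1 hx; simp at this; exact this hxA
    rw [Finset.card_union_of_disjoint hd, hU.2]; omega
  · intro U hU
    simp only [Finset.mem_filter, Finset.mem_powersetCard] at hU
    exact Finset.sdiff_union_of_subset hU.2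
  · intro U hU
    simp only [Finset.mem_powersetCard] at hU
    ext x
    have := @hU.1 x
    simp at this ⊢
    tauto

lemma aux_darts {V : Type} [Fintype V] (G : SimpleGraph V) [DecidableRel G.Adj] :
    ((Finset.univ : Finset (V × V)).filter (fun p => G.Adj p.1 p.2)).card
      = 2 * G.edgeSet.ncard := by
  classical
  rw [← SimpleGraph.coe_edgeFinset, Set.ncard_coe_finset, ← SimpleGraph.dart_card_eq_twice_card_edges,
    ← Finset.card_univ]
  symm
  refine Finset.card_bij (fun d _ => d.toProd) ?_ ?_ ?_
  · intro d _; simp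
  · intro d _ d' _ h; exact SimpleGraph.Dart.ext _ _ h
  · intro p hp
    simp at hp
    exact ⟨⟨p, hp⟩, by simp, rfl⟩

lemma aux_darts_induce {V : Type} [Fintype V] (G : SimpleGraph V) [DecidableRel G.Adj]
    [DecidableEq V] (U : Finset V) :
    ((Finset.univ.filter (fun p : V × V => G.Adj p.1 p.2)).filter
      (fun p => p.1 ∈ U ∧ p.2 ∈ U)).card
      = 2 * (G.induce (U : Set V)).edgeSet.ncard := by
  classical
  rw [← aux_darts]
  symm
  refine Finset.card_bij (fun d _ => (d.1.1, d.2.1)) ?_ ?_ ?_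
  · rintro ⟨⟨a, ha⟩, ⟨b, hb⟩⟩ h
    simp at h ha hb ⊢
    exact ⟨h, ha, hb⟩
  · rintro ⟨⟨a, ha⟩, ⟨b, hb⟩⟩ _ ⟨⟨a', ha'⟩, ⟨b', hb'⟩⟩ _ h
    simpa using h
  · rintro ⟨a, b⟩ h
    simp at h
    exact ⟨(⟨a, h.2.1⟩, ⟨b, h.2.2⟩), by simpa using h.1, rfl⟩

lemma aux_first {V : Type} [Fintype V] [DecidableEq V] (D : Finset (V × V))
    (hD : ∀ p ∈ D, p.1 ≠ p.2) (m : ℕ) (hm : 2 ≤ m) :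
    ∑ U ∈ (Finset.univ : Finset V).powersetCard m,
      (D.filter (fun p => p.1 ∈ U ∧ p.2 ∈ U)).card
      = D.card * (Fintype.card V - 2).choose (m - 2) := by
  simp only [Finset.card_filter]
  rw [Finset.sum_comm, ← smul_eq_mul, ← Finset.sum_const]
  refine Finset.sum_congr rfl fun p hp => ?_
  rw [← Finset.card_filter]
  have h2 : ({p.1, p.2} : Finset V).card = 2 := Finset.card_pair (hD p hp)
  have := aux_card_sup ({p.1, p.2} : Finset V) m (by omega)
  rw [h2] at this
  rw [← this]
  congr 1
  ext U
  simp [Finset.insert_subset_iff]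

lemma aux_second {V : Type} [Fintype V] [DecidableEq V] (D : Finset (V × V))
    (hD : ∀ p ∈ D, p.1 ≠ p.2) (m n : ℕ) (hn : n = Fintype.card V) (hm : 4 ≤ m) :
    ∑ U ∈ (Finset.univ : Finset V).powersetCard m,
      (D.filter (fun p => p.1 ∈ U ∧ p.2 ∈ U)).card ^ 2
      ≤ D.card * (D.card * (n - 4).choose (m - 4) + 2 * (n - 2).choose (m - 2)
          + 4 * n * (n - 3).choose (m - 3)) := by
  subst hn
  set n := Fintype.card V with hn
  set N2 := (n - 2).choose (m - 2)
  set N3 := (n - 3).choose (m - 3)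
  set N4 := (n - 4).choose (m - 4)
  have e1 : ∀ U : Finset V, (D.filter (fun p => p.1 ∈ U ∧ p.2 ∈ U)).card ^ 2
      = ∑ p ∈ D, ∑ q ∈ D, if (({p.1, p.2} : Finset V) ∪ {q.1, q.2}) ⊆ U then 1 else 0 := by
    intro U
    rw [sq, Finset.card_filter, Finset.sum_mul_sum]
    refine Finset.sum_congr rfl fun p _ => Finset.sum_congr rfl fun q _ => ?_
    by_cases h1 : p.1 ∈ U <;> by_cases h2 : p.2 ∈ U <;> by_cases h3 : q.1 ∈ U <;>
      by_cases h4 : q.2 ∈ U <;> simp [Finset.insert_subset_iff, h1, h2, h3, h4]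
  simp only [e1]
  rw [Finset.sum_comm, ← smul_eq_mul, ← Finset.sum_const]
  refine Finset.sum_le_sum fun p hp => ?_
  rw [Finset.sum_comm]
  have key : ∀ q ∈ D, (∑ U ∈ (Finset.univ : Finset V).powersetCard m,
      if (({p.1, p.2} : Finset V) ∪ {q.1, q.2}) ⊆ U then 1 else 0) ≤
      N4 + ((if q = p then 1 else 0) + (if q = p.swap then 1 else 0)) * N2
       + ((if q.1 = p.1 then 1 else 0) + (if q.1 = p.2 then 1 else 0)
        + (if q.2 = p.1 then 1 else 0) + (if q.2 = p.2 then 1 else 0)) * N3 := by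
    intro q hq
    have hpn := hD p hp
    have hqn := hD q hq
    obtain ⟨a, b⟩ := p
    obtain ⟨x, y⟩ := q
    simp only [Prod.mk.injEq, Prod.swap_prod_mk] at hpn hqn ⊢
    rw [← Finset.card_filter]
    have hle : (({a, b} : Finset V) ∪ {x, y}).card ≤ 4 :=
      (Finset.card_union_le _ _).trans (by
        rw [Finset.card_pair hpn, Finset.card_pair hqn])
    rw [aux_card_sup _ m (hle.trans hm), ← hn]
    by_cases h1 : x = a <;> by_cases h2 : x = b <;> by_cases h3 : y = a <;> by_cases h4 : y = b
    all_goals first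
      | (exfalso; grind)
      | (have hc : (({a, b} : Finset V) ∪ {x, y}).card = 2 := by grind
         rw [hc]; simp [h1, h2, h3, h4, hpn, hpn.symm, N2]; try omega)
      | (have hc : (({a, b} : Finset V) ∪ {x, y}).card = 3 := by grind
         rw [hc]; simp [h1, h2, h3, h4, hpn, hpn.symm, N3]; try omega)
      | (have hc : (({a, b} : Finset V) ∪ {x, y}).card = 4 := by grind
         rw [hc]; simp [h1, h2, h3, h4, N4]; try omega)
  refine (Finset.sum_le_sum key).trans ?_
  have f1 : ∀ v : V, (∑ q ∈ D, if q.1 = v then 1 else 0) ≤ n := by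
    intro v
    rw [← Finset.card_filter, hn, ← Finset.card_univ]
    refine Finset.card_le_card_of_injOn Prod.snd (by simp) ?_
    rintro ⟨a, b⟩ h ⟨a', b'⟩ h' e
    simp at h h' e; ext <;> simp [h.2, h'.2, e]
  have f2 : ∀ v : V, (∑ q ∈ D, if q.2 = v then 1 else 0) ≤ n := by
    intro v
    rw [← Finset.card_filter, hn, ← Finset.card_univ]
    refine Finset.card_le_card_of_injOn Prod.fst (by simp) ?_
    rintro ⟨a, b⟩ h ⟨a', b'⟩ h' e
    simp at h h' e; ext <;> simp [h.2, h'.2, e]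
  have f3 : ∀ v : V × V, (∑ q ∈ D, if q = v then 1 else 0) ≤ 1 := by
    intro v
    rw [Finset.sum_ite_eq']; split_ifs <;> simp
  simp only [Finset.sum_add_distrib, ← Finset.sum_mul, Finset.sum_const, smul_eq_mul]
  have g1 := f1 p.1
  have g2 := f1 p.2
  have g3 := f2 p.1
  have g4 := f2 p.2
  have g5 := f3 p
  have g6 := f3 p.swap
  gcongr
  · omega
  · omega

lemma aux_N {n m : ℕ} (hm : 4 ≤ m) (hmn : m ≤ n) :
    ((n-2).choose (m-2) : ℝ) * (n * (n-1)) = m * (m-1) * n.choose m ∧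
    (n:ℝ) * (n-3).choose (m-3) ≤ m * (n-2).choose (m-2) ∧
    ((n-4).choose (m-4) : ℝ) * (n * (n-1)) ≤ m * (m-1) * (n-2).choose (m-2) := by
  obtain ⟨k, rfl⟩ := Nat.exists_eq_add_of_le' hm
  obtain ⟨l, rfl⟩ := Nat.exists_eq_add_of_le' (hm.trans hmn)
  have h0 := Nat.add_one_mul_choose_eq (l+3) (k+3)
  have h1 := Nat.add_one_mul_choose_eq (l+2) (k+2)
  have h2 := Nat.add_one_mul_choose_eq (l+1) (k+1)
  have h3 := Nat.add_one_mul_choose_eq (l) (k)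
  have hkl : (k:ℝ) ≤ l := by exact_mod_cast (by omega : k ≤ l)
  have e1 : l + 4 - 2 = l + 2 := by omega
  have e2 : k + 4 - 2 = k + 2 := by omega
  have e3 : l + 4 - 3 = l + 1 := by omega
  have e4 : k + 4 - 3 = k + 1 := by omega
  simp only [e1, e2, e3, e4, Nat.add_sub_cancel]
  have hk0 : (0:ℝ) ≤ k := by positivity
  have hl0 : (0:ℝ) ≤ l := by positivity
  have h0' : ((l:ℝ) + 4) * (l+3).choose (k+3) = (l+4).choose (k+4) * (k + 4) := by
    have : (((l + 3 + 1) * (l+3).choose (k+3) : ℕ) : ℝ) = ((l+4).choose (k+4) * (k + 3 + 1) : ℕ) := by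
      exact_mod_cast h0
    push_cast at this; linarith
  have h1' : ((l:ℝ) + 3) * (l+2).choose (k+2) = (l+3).choose (k+3) * (k + 3) := by
    have : (((l + 2 + 1) * (l+2).choose (k+2) : ℕ) : ℝ) = ((l+3).choose (k+3) * (k + 2 + 1) : ℕ) := by
      exact_mod_cast h1
    push_cast at this; linarith
  have h2' : ((l:ℝ) + 2) * (l+1).choose (k+1) = (l+2).choose (k+2) * (k + 2) := by
    have : (((l + 1 + 1) * (l+1).choose (k+1) : ℕ) : ℝ) = ((l+2).choose (k+2) * (k + 1 + 1) : ℕ) := by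
      exact_mod_cast h2
    push_cast at this; linarith
  have h3' : ((l:ℝ) + 1) * l.choose k = (l+1).choose (k+1) * (k + 1) := by
    exact_mod_cast h3
  clear h0 h1 h2 h3
  push_cast
  have p2 : (0:ℝ) ≤ (l+2).choose (k+2) := by positivity
  have p3 : (0:ℝ) ≤ (l+1).choose (k+1) := by positivity
  have p4 : (0:ℝ) ≤ l.choose k := by positivity
  generalize ((l+4).choose (k+4) : ℝ) = N0 at *
  generalize ((l+3).choose (k+3) : ℝ) = N1 at *
  generalize ((l+2).choose (k+2) : ℝ) = N2 at *
  generalize ((l+1).choose (k+1) : ℝ) = N3 at *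
  generalize (l.choose k : ℝ) = N4 at *
  have a1 : ((l:ℝ) + 4) * N3 ≤ (k + 4) * N2 := by
    have : ((k:ℝ)+2) * ((l + 4) * N3) ≤ (k+2) * ((k + 4) * N2) := by
      nlinarith [mul_nonneg (sub_nonneg.2 hkl) p3]
    exact le_of_mul_le_mul_left this (by positivity)
  have a2 : ((l:ℝ) + 3) * N4 ≤ (k + 3) * N3 := by
    have : ((l:ℝ)+1) * ((l + 3) * N4) ≤ (l+1) * ((k + 3) * N3) := by
      nlinarith [mul_nonneg (sub_nonneg.2 hkl) p3]
    exact le_of_mul_le_mul_left this (by positivity)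
  refine ⟨?_, a1, ?_⟩
  · linear_combination (l + 4) * h1' + (k + 3) * h0'
  · have b1 := mul_le_mul_of_nonneg_left a2 (by positivity : (0:ℝ) ≤ l + 4)
    have b2 := mul_le_mul_of_nonneg_left a1 (by positivity : (0:ℝ) ≤ k + 3)
    nlinarith

lemma aux_cheb {ι : Type} (S : Finset ι) (X : ι → ℝ) (μ B : ℝ) (hμ : 0 < μ)
    (h1 : ∑ i ∈ S, X i = μ * S.card) (h2 : ∑ i ∈ S, X i ^ 2 ≤ S.card * (μ ^ 2 + μ * B))
    (hB : 16 * B ≤ μ) :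
    ((S.filter (fun i => X i ≤ μ / 2)).card : ℝ) ≤ S.card / 4 := by
  have e : ∑ i ∈ S, (X i - μ) ^ 2 = ∑ i ∈ S, X i ^ 2 - 2 * μ * ∑ i ∈ S, X i + S.card * μ ^ 2 := by
    rw [Finset.mul_sum, ← Finset.sum_sub_distrib, ← nsmul_eq_mul, ← Finset.sum_const,
      ← Finset.sum_add_distrib]
    exact Finset.sum_congr rfl fun i _ => by ring
  have l : ((S.filter (fun i => X i ≤ μ / 2)).card : ℝ) * (μ ^ 2 / 4) ≤ ∑ i ∈ S, (X i - μ) ^ 2 := by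
    rw [← nsmul_eq_mul, ← Finset.sum_const]
    refine (Finset.sum_le_sum (f := fun _ => μ ^ 2 / 4) (g := fun i => (X i - μ) ^ 2) ?_).trans
      (Finset.sum_le_sum_of_subset_of_nonneg (Finset.filter_subset _ _) fun _ _ _ => sq_nonneg _)
    intro i hi
    have := (Finset.mem_filter.1 hi).2
    nlinarith
  have u : ∑ i ∈ S, (X i - μ) ^ 2 ≤ S.card / 4 * (μ ^ 2 / 4) := by
    rw [e, h1]
    have : (S.card : ℝ) * (μ * (16 * B)) ≤ S.card * (μ * μ) := by gcongr
    nlinarith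
  exact le_of_mul_le_mul_right (l.trans u) (by positivity)

set_option maxHeartbeats 2000000 in
lemma aux_num (h : ℕ) (hh : 2 ≤ h) (ε c ε' c' : ℝ) (hε : 0 < ε) (hε2 : ε ≤ 1 / 2) (hc : 1 < c)
    (hε' : ε' = ε / (2 * h)) (hc' : c' = max (h : ℝ) c) (s n m : ℕ) (hs : 2 ≤ s) (e : ℝ)
    (he : c' * (s : ℝ) ^ 4 * (n : ℝ) ^ ((2 : ℝ) - ε') < e) (hen : e ≤ n * (n - 1) / 2)
    (hm1 : ((n : ℝ) / (4 * s)) ^ ((1 : ℝ) / h) ≤ (m : ℝ))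
    (hm2 : (m : ℝ) ≤ Real.sqrt n) :
    4 ≤ m ∧ m ≤ n ∧ 16 * (2 + 4 * (m:ℝ)) ≤ 2 * e * (m * (m - 1)) / (n * (n - 1)) ∧
      4 * (c * (s : ℝ) ^ 4 * (m : ℝ) ^ ((2 : ℝ) - ε)) ≤ 2 * e * (m * (m - 1)) / (n * (n - 1)) := by
  have hh' : (2:ℝ) ≤ h := by exact_mod_cast hh
  have hs' : (2:ℝ) ≤ s := by exact_mod_cast hs
  have hc2 : 2 ≤ c' := by rw [hc']; exact hh'.trans (le_max_left _ _)
  have hcc : c ≤ c' := by rw [hc']; exact le_max_right _ _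
  have hn0 : 1 ≤ n := by
    rcases Nat.eq_zero_or_pos n with h0 | h0
    · subst h0
      have : (0:ℝ) ≤ c' * (s : ℝ) ^ 4 * ((0:ℕ) : ℝ) ^ ((2 : ℝ) - ε') := by positivity
      simp at hen
      linarith
    · exact h0
  have hn1 : (1:ℝ) ≤ n := by exact_mod_cast hn0
  have hnpos : (0:ℝ) < n := by linarith
  set K := (n:ℝ) ^ ε' with hK
  have hKpos : 0 < K := by positivity
  have hpow : (n : ℝ) ^ ((2 : ℝ) - ε') = n ^ 2 / K := by
    rw [Real.rpow_sub hnpos, hK]; norm_num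
  rw [hpow] at he
  have hK1 : 4 * (s:ℝ) ^ 4 ≤ K := by
    have h1 : c' * (s:ℝ)^4 * ((n:ℝ) ^ 2 / K) < n ^ 2 / 2 := by nlinarith
    have h2 : c' * (s:ℝ)^4 * 2 * (n:ℝ)^2 < K * n ^ 2 := by
      rw [← mul_div_assoc, div_lt_iff₀ hKpos] at h1
      linarith
    have h3 := lt_of_mul_lt_mul_right h2 (by positivity)
    have : 2 * (s:ℝ)^4 ≤ c' * s^4 := by gcongr
    linarith
  have hs3 : 8 ≤ (s:ℝ)^3 := by nlinarith [sq_nonneg ((s:ℝ) - 2)]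
  have hs4 : 8 * (s:ℝ) ≤ s^4 := by nlinarith
  have hK64 : 64 ≤ K := by linarith
  have hm0 : (0:ℝ) < m := lt_of_lt_of_le (by positivity) hm1
  have hm1' : (1:ℝ) ≤ m := by exact_mod_cast (Nat.pos_of_ne_zero (by rintro rfl; simp at hm0))
  -- key bound on `m ^ ε`
  have hkey : K ^ 2 ≤ 4 * s * (m:ℝ) ^ ε := by
    have h1 : (((n : ℝ) / (4 * s)) ^ ((1 : ℝ) / h)) ^ ε ≤ (m:ℝ) ^ ε :=
      Real.rpow_le_rpow (by positivity) hm1 hε.le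
    rw [← Real.rpow_mul (by positivity), Real.div_rpow (by positivity) (by positivity)] at h1
    have h2 : (n:ℝ) ^ (1 / (h:ℝ) * ε) = K ^ 2 := by
      rw [hK, ← Real.rpow_natCast, ← Real.rpow_mul (by positivity), hε']
      congr 1
      field_simp
      norm_num
    have h3 : (4 * (s:ℝ)) ^ (1 / (h:ℝ) * ε) ≤ 4 * s := by
      conv_rhs => rw [← Real.rpow_one (4 * (s:ℝ))]
      apply Real.rpow_le_rpow_of_exponent_le (by linarith)
      have : 1 / (h:ℝ) ≤ 1 := by rw [div_le_one (by linarith)]; linarith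
      nlinarith
    rw [h2, div_le_iff₀ (by positivity)] at h1
    refine h1.trans ?_
    rw [mul_comm]
    gcongr
  have hP : 0 < (m:ℝ) ^ ε := by positivity
  have hmP : ((m:ℝ) ^ ε) ^ 2 ≤ m := by
    rw [← Real.rpow_natCast, ← Real.rpow_mul (by positivity)]
    conv_rhs => rw [← Real.rpow_one (m:ℝ)]
    apply Real.rpow_le_rpow_of_exponent_le hm1'
    push_cast; linarith
  have hmpow : (m:ℝ) ^ ((2:ℝ) - ε) = m ^ 2 / (m:ℝ) ^ ε := by
    rw [Real.rpow_sub hm0]; norm_num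
  rw [hmpow]
  set P := (m:ℝ) ^ ε
  -- `m` is large
  have hPK : 8 * K ≤ P := by
    have : 32 * s ≤ K := by linarith
    have h1 : 8 * K * (4 * s) ≤ P * (4 * s) := by nlinarith
    exact le_of_mul_le_mul_right h1 (by positivity)
  have hmK : 64 * K ^ 2 ≤ m := by nlinarith
  have hm4 : (4:ℝ) ≤ m := by nlinarith
  have hmn : (m:ℝ) ≤ n := hm2.trans (by
    rw [Real.sqrt_le_left (by positivity)]; nlinarith)
  have hn4 : (4:ℝ) ≤ n := hm4.trans hmn
  have hnn : 0 < (n:ℝ) * (n - 1) := mul_pos hnpos (by linarith)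
  have hmm : 0 < (m:ℝ) * (m - 1) := mul_pos hm0 (by linarith)
  have hμ : 2 * c' * s ^ 4 * (m * (m - 1)) / K ≤ 2 * e * (m * (m - 1)) / (n * (n - 1)) := by
    rw [le_div_iff₀ hnn]
    have h1 : c' * (s:ℝ)^4 * (n * (n - 1)) / K ≤ e := by
      refine le_trans ?_ he.le
      rw [← mul_div_assoc]
      gcongr
      nlinarith
    calc 2 * c' * (s:ℝ) ^ 4 * (m * (m - 1)) / K * (n * (n - 1))
        = 2 * (c' * (s:ℝ)^4 * (n * (n - 1)) / K) * (m * (m - 1)) := by ring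
      _ ≤ _ := by gcongr
  refine ⟨by exact_mod_cast hm4, by exact_mod_cast hmn, le_trans ?_ hμ, le_trans ?_ hμ⟩
  · rw [le_div_iff₀ hKpos]
    have h1 : (2:ℝ) * 2 * 16 * (m * (m-1)) ≤ 2 * c' * s^4 * (m * (m-1)) := by
      have : (16:ℝ) ≤ s^4 := by linarith
      gcongr
    refine le_trans ?_ h1
    have h2 : 16 * (2 + 4 * (m:ℝ)) ≤ 32 * 3 * m := by linarith
    have h3 : 4 * K ≤ m - 1 := by nlinarith
    nlinarith [mul_le_mul_of_nonneg_right h2 hKpos.le, mul_le_mul_of_nonneg_left h3 hm0.le]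
  · rw [le_div_iff₀ hKpos]
    have h1 : (m:ℝ)^2 / P * (2 * K) ≤ m * (m - 1) := by
      have : 2 * K / P ≤ 1 / 4 := by rw [div_le_iff₀ hP]; linarith
      calc (m:ℝ)^2 / P * (2 * K) = (m:ℝ)^2 * (2 * K / P) := by ring
        _ ≤ (m:ℝ)^2 * (1/4) := by gcongr
        _ ≤ _ := by nlinarith
    calc 4 * (c * (s:ℝ)^4 * (m^2/P)) * K = 2 * c * s^4 * (m^2 / P * (2 * K)) := by ring
      _ ≤ 2 * c' * s^4 * (m * (m-1)) := by gcongr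

/-- Under the extremal hypothesis for `H`, with `ε' = ε/(2|H|)` and
`c' = max{|H|, c}`, if `G` is an `n`-vertex graph with more than `c'·s⁴·n^(2-ε')` edges and
`(n/(4s))^(1/|H|) ≤ m ≤ √n`, then at least a `3/4` proportion of the `m`-element vertex
subsets `U` of `G` satisfy `e(G[U]) > c·s⁴·m^(2-ε)`. -/
theorem stmt_6 {VH : Type} [Fintype VH] (H : SimpleGraph VH) (hH : H.Colorable 2)
    (hVH : 2 ≤ Fintype.card VH)
    (ε c : ℝ) (hε : 0 < ε) (hε2 : ε ≤ 1 / 2) (hc : 1 < c) (hext : ExtremalBound H ε c)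
    (ε' c' : ℝ) (hε' : ε' = ε / (2 * Fintype.card VH))
    (hc' : c' = max (Fintype.card VH : ℝ) c)
    (s : ℕ) (hs : 2 ≤ s)
    {V : Type} [Fintype V] (G : SimpleGraph V) (n : ℕ) (hn : n = Fintype.card V)
    (hedges : c' * (s : ℝ) ^ 4 * (n : ℝ) ^ ((2 : ℝ) - ε') < (G.edgeSet.ncard : ℝ))
    (m : ℕ) (hm1 : ((n : ℝ) / (4 * s)) ^ ((1 : ℝ) / Fintype.card VH) ≤ (m : ℝ))
    (hm2 : (m : ℝ) ≤ Real.sqrt n) :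
    (3 : ℝ) / 4 * (n.choose m) ≤
      (({U : Finset V | U.card = m ∧
          c * (s : ℝ) ^ 4 * (m : ℝ) ^ ((2 : ℝ) - ε) <
            ((G.induce (U : Set V)).edgeSet.ncard : ℝ)}).ncard : ℝ) := by
  classical
  set D := (Finset.univ : Finset (V × V)).filter (fun p => G.Adj p.1 p.2) with hD
  have hDc : D.card = 2 * G.edgeSet.ncard := aux_darts G
  have hDne : ∀ p ∈ D, p.1 ≠ p.2 := fun p hp => by
    simp only [hD, Finset.mem_filter] at hp
    exact hp.2.ne
  have hen : (G.edgeSet.ncard : ℝ) ≤ n * (n - 1) / 2 := by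
    have h1 : D.card ≤ n * n - n := by
      have h2 : D ⊆ (Finset.univ : Finset V).offDiag := fun p hp => by
        simpa using hDne p hp
      have := Finset.card_le_card h2
      rwa [Finset.offDiag_card, Finset.card_univ, ← hn] at this
    rw [hDc] at h1
    have h3 : 2 * G.edgeSet.ncard + n ≤ n * n := by
      have : n ≤ n * n := Nat.le_mul_self n
      omega
    have h4 : (2 * G.edgeSet.ncard + n : ℝ) ≤ n * n := by exact_mod_cast h3
    linarith
  obtain ⟨hm4, hmn, hB, hT⟩ := aux_num _ hVH ε c ε' c' hε hε2 hc hε' hc' s n m hs _ hedges hen hm1 hm2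
  obtain ⟨hN1, hN2, hN3⟩ := aux_N hm4 hmn
  set μ : ℝ := 2 * G.edgeSet.ncard * (m * (m - 1)) / (n * (n - 1)) with hμ
  have hm4' : (4:ℝ) ≤ m := by exact_mod_cast hm4
  have hmn' : (m:ℝ) ≤ n := by exact_mod_cast hmn
  have hnn : 0 < (n:ℝ) * (n - 1) := mul_pos (by linarith) (by linarith)
  have hμpos : 0 < μ := by linarith
  set S := (Finset.univ : Finset V).powersetCard m with hS
  have hSc : S.card = n.choose m := by
    rw [hS, Finset.card_powersetCard, Finset.card_univ, hn]
  let X : Finset V → ℝ := fun U => ((D.filter (fun p => p.1 ∈ U ∧ p.2 ∈ U)).card : ℝ)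
  have hX : ∀ U, X U = 2 * ((G.induce (U : Set V)).edgeSet.ncard : ℝ) := fun U => by
    have := aux_darts_induce G U
    simp only [X]
    rw [this]; push_cast; rfl
  have hDr : (D.card : ℝ) = 2 * G.edgeSet.ncard := by rw [hDc]; push_cast; rfl
  have hDN : (D.card : ℝ) * (n - 2).choose (m - 2) = μ * S.card := by
    rw [hSc, hμ, ← hDr, div_mul_eq_mul_div, eq_div_iff hnn.ne']
    linear_combination (D.card : ℝ) * hN1
  have hs1 : ∑ U ∈ S, X U = μ * S.card := by
    have := aux_first D hDne m (by omega)
    rw [← hn] at this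
    rw [← hDN]
    simp only [X]
    exact_mod_cast this
  have hs2 : ∑ U ∈ S, X U ^ 2 ≤ S.card * (μ ^ 2 + μ * (2 + 4 * m)) := by
    have h1 := aux_second D hDne m n hn hm4
    have h2 : ∑ U ∈ S, X U ^ 2 ≤ (D.card : ℝ) * (D.card * (n - 4).choose (m - 4)
        + 2 * (n - 2).choose (m - 2) + 4 * n * (n - 3).choose (m - 3)) := by
      simp only [X]
      exact_mod_cast h1
    refine h2.trans ?_
    have h3 : (D.card : ℝ) * (n - 4).choose (m - 4) ≤ μ * (n - 2).choose (m - 2) := by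
      rw [hμ, ← hDr, div_mul_eq_mul_div, le_div_iff₀ hnn]
      have := mul_le_mul_of_nonneg_left hN3 (Nat.cast_nonneg (α := ℝ) D.card)
      linarith
    calc (D.card : ℝ) * (D.card * (n - 4).choose (m - 4)
        + 2 * (n - 2).choose (m - 2) + 4 * n * (n - 3).choose (m - 3))
        ≤ D.card * (μ * (n - 2).choose (m - 2) + 2 * (n - 2).choose (m - 2)
          + 4 * (m * (n - 2).choose (m - 2))) := by
          apply mul_le_mul_of_nonneg_left _ (Nat.cast_nonneg _)
          linarith
      _ = (μ + 2 + 4 * m) * (D.card * (n - 2).choose (m - 2)) := by ring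
      _ = S.card * (μ ^ 2 + μ * (2 + 4 * m)) := by rw [hDN]; ring
  have hbad := aux_cheb S X μ (2 + 4 * m) hμpos hs1 hs2 hB
  have hsub : ((S.filter (fun U => ¬ X U ≤ μ / 2) : Finset (Finset V)) : Set (Finset V)) ⊆
      {U : Finset V | U.card = m ∧ c * (s : ℝ) ^ 4 * (m : ℝ) ^ ((2 : ℝ) - ε) <
            ((G.induce (U : Set V)).edgeSet.ncard : ℝ)} := by
    intro U hU
    simp only [Finset.coe_filter, Set.mem_ofPred_eq, hS, Finset.mem_powersetCard, hX] at hU ⊢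
    refine ⟨hU.1.2, ?_⟩
    have := hU.2
    linarith
  have hcard := Set.ncard_le_ncard hsub (Set.toFinite _)
  rw [Set.ncard_coe_finset] at hcard
  have hcard' : ((S.filter (fun U => ¬ X U ≤ μ / 2)).card : ℝ) ≤ _ := Nat.cast_le.2 hcard
  refine le_trans ?_ hcard'
  have hsplit := Finset.card_filter_add_card_filter_not (s := S) (fun U => X U ≤ μ / 2)
  have hsplit' : ((S.filter (fun U => X U ≤ μ / 2)).card : ℝ)
      + ((S.filter (fun U => ¬ X U ≤ μ / 2)).card : ℝ) = S.card := by exact_mod_cast hsplit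
  rw [← hSc]
  linarith
end

section
/- Let H be a bipartite graph with |V(H)| ≥ 2 and let 0 < ε ≤ 1/2 and c > 1 be constants such that for every integer s ≥ 1 and every n, every n-vertex graph with no K_{s,s} subgraph and no induced subgraph isomorphic to H has at most c·s^4·n^{2−ε} edges. Set ε' = ε/(2|V(H)|) and c' = max{|V(H)|, c}. Let s ≥ 2 be an integer and let G be an n-vertex graph with no K_{s,s} subgraph and with e(G) > c'·s^4·n^{2−ε'}. Then G contains at least 2s·n^{|V(H)|−1} distinct induced copies of H, i.e., there are at least 2s·n^{|V(H)|−1} vertex subsets Y ⊆ V(G) with G[Y] isomorphic to H. -/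
open SimpleGraph

open Finset in
lemma aux_count {V : Type} [Fintype V] [DecidableEq V] (m : ℕ) (Y : Finset V) (hk : #Y ≤ m) :
    #{S ∈ powersetCard m (univ : Finset V) | Y ⊆ S} = (Fintype.card V - #Y).choose (m - #Y) := by
  rw [← card_compl, ← card_powersetCard]
  symm
  apply card_bij' (fun T _ => Y ∪ T) (fun S _ => S \ Y)
  · intro T hT
    rw [mem_powersetCard] at hT
    have hd : Disjoint Y T := by
      rw [Finset.disjoint_left]; intro x hx hx'
      exact (mem_compl.1 (hT.1 hx')) hx
    simp only [mem_filter, mem_powersetCard, subset_univ, true_and]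
    rw [card_union_of_disjoint hd]
    exact ⟨by omega, subset_union_left⟩
  · intro S hS
    simp only [mem_filter, mem_powersetCard, subset_univ, true_and] at hS
    rw [mem_powersetCard, card_sdiff_of_subset hS.2]
    refine ⟨fun x hx => ?_, by omega⟩
    simp at hx ⊢; exact hx.2
  · intro T hT
    rw [mem_powersetCard] at hT
    ext x
    have := @hT.1 x
    simp at this ⊢
    tauto
  · intro S hS
    simp only [mem_filter, mem_powersetCard, subset_univ, true_and] at hS
    exact union_sdiff_of_subset hS.2

lemma aux_step (n m k : ℕ) (hmn : m ≤ n) (hk : k < m) :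
    (n - (k+1)).choose (m - (k+1)) * n ≤ (n - k).choose (m - k) * m := by
  obtain ⟨a, rfl⟩ : ∃ a, m = k + 1 + a := ⟨m - (k+1), by omega⟩
  obtain ⟨b, rfl⟩ : ∃ b, n = k + 1 + a + b := ⟨n - (k+1+a), by omega⟩
  have h := Nat.add_one_mul_choose_eq (a + b) a
  have e1 : k + 1 + a + b - (k+1) = a + b := by omega
  have e2 : k + 1 + a - (k+1) = a := by omega
  have e3 : k + 1 + a + b - k = a + b + 1 := by omega
  have e4 : k + 1 + a - k = a + 1 := by omega
  rw [e1, e2, e3, e4]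
  have hp : 0 < a + b + 1 := by omega
  refine Nat.le_of_mul_le_mul_left ?_ hp
  calc (a + b + 1) * ((a+b).choose a * (k + 1 + a + b))
      = ((a + b + 1) * (a+b).choose a) * (k + 1 + a + b) := by ring
    _ = (a+b+1).choose (a+1) * ((a+1) * (k + 1 + a + b)) := by rw [h]; ring
    _ ≤ (a+b+1).choose (a+1) * ((a + b + 1) * (k + 1 + a)) := by
        apply Nat.mul_le_mul_left; nlinarith [Nat.zero_le (k*b)]
    _ = _ := by ring

lemma aux_iter (n m k : ℕ) (hmn : m ≤ n) (hk : k ≤ m) :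
    (n - k).choose (m - k) * n ^ k ≤ n.choose m * m ^ k := by
  induction k with
  | zero => simp
  | succ k ih =>
    calc (n - (k+1)).choose (m - (k+1)) * n ^ (k+1)
        = ((n - (k+1)).choose (m - (k+1)) * n) * n ^ k := by ring
      _ ≤ ((n - k).choose (m - k) * m) * n ^ k := Nat.mul_le_mul_right _ (aux_step n m k hmn hk)
      _ = ((n - k).choose (m - k) * n ^ k) * m := by ring
      _ ≤ (n.choose m * m ^ k) * m := Nat.mul_le_mul_right _ (ih (by omega))
      _ = _ := by ring

lemma aux_two (n m : ℕ) (hmn : m ≤ n) (hm : 2 ≤ m) :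
    n.choose m * (m * (m - 1)) ≤ (n - 2).choose (m - 2) * n ^ 2 := by
  obtain ⟨a, rfl⟩ : ∃ a, m = a + 2 := ⟨m - 2, by omega⟩
  obtain ⟨b, rfl⟩ : ∃ b, n = b + 2 := ⟨n - 2, by omega⟩
  have h1 := Nat.add_one_mul_choose_eq (b+1) (a+1)
  have h2 := Nat.add_one_mul_choose_eq b a
  simp only [Nat.succ_eq_add_one, add_assoc] at h1 h2
  norm_num at h1 h2
  have e : a + 2 - 1 = a + 1 := by omega
  rw [e]
  simp only [Nat.add_sub_cancel]
  calc (b+2).choose (a+2) * ((a+2)*(a+1)) = ((b+2).choose (a+2) * (a+2))*(a+1) := by ring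
    _ = (b+2) * ((b+1).choose (a+1) * (a+1)) := by rw [← h1]; ring
    _ = (b+2) * ((b+1) * b.choose a) := by rw [h2]
    _ ≤ _ := by nlinarith [Nat.zero_le ((b+2) * b.choose a)]

open Finset in
/-- The double counting inequality. -/
lemma aux_double {VH V : Type} [Fintype VH] [Fintype V] [DecidableEq V] (H : SimpleGraph VH)
    (G : SimpleGraph V) (m : ℕ) (hm : 2 ≤ m) (hmn : m ≤ Fintype.card V) (B : ℝ) (hB : 0 ≤ B)
    (hloc : ∀ S : Finset V, #S = m → ¬ HasInducedCopy (G.induce (S : Set V)) H →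
      ((G.induce (S : Set V)).edgeSet.ncard : ℝ) ≤ B) :
    (G.edgeSet.ncard : ℝ) * (m * (m - 1)) / (Fintype.card V : ℝ) ^ 2 ≤
      B + (m : ℝ) ^ 2 * (({Y : Set V | Nonempty ((G.induce Y) ≃g H)}).ncard : ℝ) *
        ((m : ℝ) / Fintype.card V) ^ (Fintype.card VH) := by
  classical
  set n := Fintype.card V with hn
  set h := Fintype.card VH with hh
  set E : Finset (Sym2 V) := G.edgeFinset with hE
  set C : Finset (Finset V) := {Y | Nonempty ((G.induce (Y : Set V)) ≃g H)} with hC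
  set P := powersetCard m (univ : Finset V) with hP
  have hn0 : (0:ℝ) < n := by exact_mod_cast (by omega : 0 < n)
  have hEcard : G.edgeSet.ncard = #E := by
    rw [hE, ← SimpleGraph.coe_edgeFinset, Set.ncard_coe_finset]
  have hCcard : #C ≤ ({Y : Set V | Nonempty ((G.induce Y) ≃g H)}).ncard := by
    rw [← Set.ncard_coe_finset, ← Set.ncard_image_of_injective _ (Finset.coe_injective (α := V))]
    apply Set.ncard_le_ncard _ (Set.toFinite _)
    rintro _ ⟨Y, hY, rfl⟩
    simpa [hC] using hY
  have hCh : ∀ Y ∈ C, #Y = h := by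
    intro Y hY
    obtain ⟨f⟩ := (mem_filter.1 hY).2
    have := Fintype.card_congr f.toEquiv
    rw [hh, ← this]; simp
  have hPcard : #P = n.choose m := by rw [hP, card_powersetCard, card_univ]
  have hsub : ∀ S : Finset V, #{e ∈ E | e.toFinset ⊆ S} ≤ (G.induce (S : Set V)).edgeSet.ncard := by
    intro S
    rw [← Set.ncard_coe_finset]
    refine le_trans (Set.ncard_le_ncard (t := (Sym2.map Subtype.val) '' (G.induce (S : Set V)).edgeSet) ?_ (Set.toFinite _)) (Set.ncard_image_le (Set.toFinite _))
    intro e he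
    induction e with | _ x y => ?_
    simp only [coe_filter, Set.mem_ofPred_eq, hE, SimpleGraph.mem_edgeFinset, SimpleGraph.mem_edgeSet] at he
    have hx : x ∈ S := he.2 (by simp)
    have hy : y ∈ S := he.2 (by simp)
    exact ⟨s(⟨x, hx⟩, ⟨y, hy⟩), by simpa using he.1, by simp⟩
  have hS : ∀ S ∈ P, (#{e ∈ E | e.toFinset ⊆ S} : ℝ) ≤ B + (m:ℝ)^2 * #{Y ∈ C | Y ⊆ S} := by
    intro S hSP
    have hSm : #S = m := (mem_powersetCard.1 hSP).2
    by_cases hcopy : HasInducedCopy (G.induce (S : Set V)) H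
    · obtain ⟨T, ⟨f⟩⟩ := hcopy
      have h1 : 1 ≤ #{Y ∈ C | Y ⊆ S} := by
        rw [Nat.succ_le_iff, card_pos]
        refine ⟨(Subtype.val '' T).toFinset, ?_⟩
        rw [mem_filter, hC, mem_filter]
        refine ⟨⟨mem_univ _, ?_⟩, ?_⟩
        · rw [Set.coe_toFinset]
          refine ⟨RelIso.trans (RelIso.symm ?_) f⟩
          refine ⟨Equiv.Set.image _ T Subtype.val_injective, ?_⟩
          intro a b
          simp [SimpleGraph.comap_adj]
        · intro x hx
          simp at hx
          exact hx.1
      have h2 : (#{e ∈ E | e.toFinset ⊆ S} : ℝ) ≤ (m:ℝ)^2 := by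
        have a1 := hsub S
        have a2 : (G.induce (S : Set V)).edgeSet.ncard ≤ m ^ 2 := by
          rw [← SimpleGraph.coe_edgeFinset, Set.ncard_coe_finset]
          refine (SimpleGraph.card_edgeFinset_le_card_choose_two).trans ?_
          have : Fintype.card (S : Set V) = m := by simp [hSm]
          rw [this]
          exact Nat.choose_le_pow m 2
        exact_mod_cast a1.trans a2
      have h1' : (1:ℝ) ≤ #{Y ∈ C | Y ⊆ S} := by exact_mod_cast h1
      nlinarith [sq_nonneg (m:ℝ)]
    · have := hloc S hSm hcopy
      have h2 : (#{e ∈ E | e.toFinset ⊆ S} : ℝ) ≤ (G.induce (S : Set V)).edgeSet.ncard := by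
        exact_mod_cast hsub S
      have : (0:ℝ) ≤ (m:ℝ)^2 * #{Y ∈ C | Y ⊆ S} := by positivity
      linarith
  have hsum := sum_le_sum hS
  rw [sum_add_distrib, ← mul_sum, sum_const, nsmul_eq_mul, hPcard] at hsum
  have s1 : ∑ S ∈ P, (#{e ∈ E | e.toFinset ⊆ S} : ℝ) = #E * ((n-2).choose (m-2) : ℝ) := by
    have : ∑ S ∈ P, #{e ∈ E | e.toFinset ⊆ S} = ∑ e ∈ E, #{S ∈ P | e.toFinset ⊆ S} :=
      sum_card_bipartiteAbove_eq_sum_card_bipartiteBelow (fun (S : Finset V) (e : Sym2 V) => e.toFinset ⊆ S)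
    have h2 : ∑ e ∈ E, #{S ∈ P | e.toFinset ⊆ S} = #E * (n-2).choose (m-2) := by
      rw [sum_const_nat]
      intro e he
      have hc : #e.toFinset = 2 := by
        apply Sym2.card_toFinset_of_not_isDiag
        exact G.not_isDiag_of_mem_edgeFinset he
      rw [hP, aux_count m _ (by omega), hc]
    rw [h2] at this
    exact_mod_cast this
  have s2 : (∑ S ∈ P, (#{Y ∈ C | Y ⊆ S} : ℝ)) * (n:ℝ)^h ≤ #C * ((n.choose m : ℝ) * (m:ℝ)^h) := by
    have : ∑ S ∈ P, #{Y ∈ C | Y ⊆ S} = ∑ Y ∈ C, #{S ∈ P | Y ⊆ S} :=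
      sum_card_bipartiteAbove_eq_sum_card_bipartiteBelow (fun (S : Finset V) (Y : Finset V) => Y ⊆ S)
    have h2 : (∑ Y ∈ C, #{S ∈ P | Y ⊆ S}) * n^h ≤ #C * (n.choose m * m^h) := by
      rw [sum_mul, ← smul_eq_mul]
      apply sum_le_card_nsmul
      intro Y hY
      have hYh := hCh Y hY
      by_cases hhm : h ≤ m
      · rw [hP, aux_count m _ (by omega), hYh]
        exact aux_iter n m h hmn hhm
      · have : #{S ∈ P | Y ⊆ S} = 0 := by
          rw [card_eq_zero, filter_eq_empty_iff]
          intro S hSP hsub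
          have := card_le_card hsub
          rw [(mem_powersetCard.1 hSP).2] at this
          omega
        rw [this]; simp
    rw [← this] at h2
    exact_mod_cast h2
  have s3 : (n.choose m : ℝ) * (m * (m - 1)) ≤ ((n-2).choose (m-2) : ℝ) * (n:ℝ)^2 := by
    have := aux_two n m hmn hm
    have hc : ((m - 1 : ℕ) : ℝ) = (m:ℝ) - 1 := by rw [Nat.cast_sub (by omega)]; simp
    rw [← hc]; exact_mod_cast this
  rw [s1] at hsum
  have hCh0 : (0:ℝ) < n.choose m := by exact_mod_cast Nat.choose_pos hmn
  set X := ∑ S ∈ P, (#{Y ∈ C | Y ⊆ S} : ℝ) with hX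
  have s2' : X ≤ #C * (n.choose m : ℝ) * ((m:ℝ)/n)^h := by
    rw [div_pow, mul_div_assoc', le_div_iff₀ (by positivity)]
    linarith
  have s3' : (n.choose m : ℝ) * (m * (m - 1)) / (n:ℝ)^2 ≤ ((n-2).choose (m-2) : ℝ) := by
    rw [div_le_iff₀ (by positivity)]; exact s3
  rw [hEcard]
  have hCc : (#C : ℝ) ≤ (({Y : Set V | Nonempty ((G.induce Y) ≃g H)}).ncard : ℝ) := by
    exact_mod_cast hCcard
  refine le_of_mul_le_mul_left ?_ hCh0
  calc (n.choose m : ℝ) * ((#E : ℝ) * (m * (m - 1)) / (n:ℝ)^2)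
      = #E * ((n.choose m : ℝ) * (m * (m - 1)) / (n:ℝ)^2) := by ring
    _ ≤ #E * ((n-2).choose (m-2) : ℝ) := by gcongr
    _ ≤ _ := hsum
    _ ≤ n.choose m * B + (m:ℝ)^2 * (#C * (n.choose m : ℝ) * ((m:ℝ)/n)^h) := by gcongr
    _ = n.choose m * (B + (m:ℝ)^2 * #C * ((m:ℝ)/n)^h) := by ring
    _ ≤ _ := by gcongr

set_option maxHeartbeats 1000000 in
lemma aux_numeric (h n s : ℕ) (hh : 2 ≤ h) (hs : 2 ≤ s) (hn : 0 < n) (ε ε' c c' e N : ℝ)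
    (hε : 0 < ε) (hε2 : ε ≤ 1 / 2) (hc : 1 < c)
    (hε' : ε' = ε / (2 * h)) (hc' : c' = max (h : ℝ) c)
    (he : e ≤ (n : ℝ) ^ 2 / 2)
    (hedges : c' * (s : ℝ) ^ 4 * (n : ℝ) ^ ((2 : ℝ) - ε') < e)
    (hN : 0 ≤ N)
    (hmain : ∀ m : ℕ, 2 ≤ m → m ≤ n →
      e * (m * (m - 1)) / (n : ℝ) ^ 2 ≤ c * (s : ℝ) ^ 4 * (m : ℝ) ^ ((2 : ℝ) - ε) +
        (m : ℝ) ^ 2 * N * ((m : ℝ) / n) ^ h) :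
    2 * (s : ℝ) * (n : ℝ) ^ (h - 1) ≤ N := by
  have hnR : (0:ℝ) < n := by exact_mod_cast hn
  have hn1 : (1:ℝ) ≤ n := by exact_mod_cast hn
  have hhR : (2:ℝ) ≤ h := by exact_mod_cast hh
  have hsR : (2:ℝ) ≤ s := by exact_mod_cast hs
  have hc2 : 2 ≤ c' := by rw [hc']; exact hhR.trans (le_max_left _ _)
  have hcc : c ≤ c' := by rw [hc']; exact le_max_right _ _
  have hs3 : (8:ℝ) ≤ (s:ℝ)^3 := by
    calc (8:ℝ) = 2^3 := by norm_num
      _ ≤ _ := by gcongr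
  have hs4 : (16:ℝ) ≤ (s:ℝ)^4 := by
    calc (16:ℝ) = 2^4 := by norm_num
      _ ≤ _ := by gcongr
  set t := (n:ℝ) ^ ε' with ht
  have ht0 : 0 < t := by positivity
  have hnt : (n : ℝ) ^ ((2 : ℝ) - ε') = (n:ℝ)^2 / t := by
    rw [Real.rpow_sub hnR]; norm_num; rfl
  rw [hnt] at hedges
  have ht64 : 64 < t := by
    have h1 := hedges.trans_le he
    have h2 : c' * (s:ℝ)^4 / t < 1 / 2 := by
      have hn2 : 0 < (n:ℝ)^2 := by positivity
      refine lt_of_mul_lt_mul_right ?_ hn2.le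
      calc c' * (s:ℝ)^4 / t * (n:ℝ)^2 = c' * (s : ℝ) ^ 4 * ((n:ℝ)^2 / t) := by ring
        _ < _ := h1
        _ = _ := by ring
    rw [div_lt_iff₀ ht0] at h2
    have : (32:ℝ) ≤ c' * (s:ℝ)^4 := by nlinarith
    linarith
  set x := (n:ℝ) ^ (1 / (2 * (h:ℝ))) with hx
  have hx0 : 0 < x := by positivity
  have hx1 : 1 ≤ x := Real.one_le_rpow hn1 (by positivity)
  have hxt : x ^ ε = t := by
    rw [hx, ht, ← Real.rpow_mul hnR.le, hε']; congr 1; ring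
  have hx4096 : 4096 < x := by
    have h1 : x ^ ε ≤ x ^ (1/2 : ℝ) := Real.rpow_le_rpow_of_exponent_le hx1 hε2
    have h2 : 64 < x ^ (1/2:ℝ) := by linarith
    rw [← Real.sqrt_eq_rpow] at h2
    have := (Real.lt_sqrt (by norm_num)).1 h2
    linarith
  set m := ⌊x ^ (3/2:ℝ)⌋₊ with hm
  have hmle : (m:ℝ) ≤ x ^ (3/2:ℝ) := Nat.floor_le (by positivity)
  have hmge : x ^ (4/3:ℝ) ≤ m := by
    have h1 : x ^ (3/2:ℝ) < m + 1 := Nat.lt_floor_add_one _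
    have h2 : x ^ (3/2:ℝ) = x ^ (4/3:ℝ) * x ^ (1/6:ℝ) := by
      rw [← Real.rpow_add hx0]; norm_num
    have h3 : (2:ℝ) ≤ x ^ (1/6:ℝ) := by
      calc (2:ℝ) = (64:ℝ) ^ (1/6:ℝ) := by
            rw [show (64:ℝ) = 2 ^ (6:ℝ) by norm_num, ← Real.rpow_mul (by norm_num)]; norm_num
        _ ≤ _ := Real.rpow_le_rpow (by norm_num) (by linarith) (by norm_num)
    have h4 : 1 ≤ x ^ (4/3:ℝ) := Real.one_le_rpow hx1 (by norm_num)
    nlinarith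
  have hm2R : (2:ℝ) ≤ m := by
    have : x ^ (1:ℝ) ≤ x ^ (4/3:ℝ) := Real.rpow_le_rpow_of_exponent_le hx1 (by norm_num)
    rw [Real.rpow_one] at this
    linarith
  have hm0 : (0:ℝ) < m := by linarith
  have hmh : (m:ℝ)^h ≤ (n:ℝ) ^ (3/4:ℝ) := by
    calc (m:ℝ)^h ≤ (x ^ (3/2:ℝ))^h := by gcongr
      _ = _ := by
        rw [hx, ← Real.rpow_natCast, ← Real.rpow_mul hnR.le, ← Real.rpow_mul hnR.le]
        congr 1; field_simp; norm_num
  have hmn : m ≤ n := by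
    have h1 : (m:ℝ)^1 ≤ (m:ℝ)^h := pow_le_pow_right₀ (by linarith) (by omega)
    have h2 : (n:ℝ) ^ (3/4:ℝ) ≤ (n:ℝ)^(1:ℝ) := Real.rpow_le_rpow_of_exponent_le hn1 (by norm_num)
    rw [Real.rpow_one] at h2
    have : (m:ℝ) ≤ n := by linarith
    exact_mod_cast this
  have hM := hmain m (by exact_mod_cast hm2R) hmn
  have hmε : 4 * t ≤ (m:ℝ)^ε := by
    have h1 : x ^ (4/3 * ε : ℝ) ≤ (m:ℝ)^ε := by
      rw [Real.rpow_mul hx0.le]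
      exact Real.rpow_le_rpow (by positivity) hmge hε.le
    have h2 : x ^ (4/3 * ε : ℝ) = t * t ^ (1/3:ℝ) := by
      rw [← hxt, ← Real.rpow_mul hx0.le, ← Real.rpow_add hx0]; congr 1; ring
    have h3 : (4:ℝ) ≤ t ^ (1/3:ℝ) := by
      calc (4:ℝ) = (64:ℝ) ^ (1/3:ℝ) := by
            rw [show (64:ℝ) = 4 ^ (3:ℝ) by norm_num, ← Real.rpow_mul (by norm_num)]; norm_num
        _ ≤ _ := Real.rpow_le_rpow (by norm_num) (by linarith) (by norm_num)
    nlinarith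
  have hms : (m:ℝ) ^ ((2:ℝ) - ε) ≤ (m:ℝ)^2 / (4 * t) := by
    rw [Real.rpow_sub hm0]
    norm_num
    gcongr
  -- lower bound for the left side
  have hL : c' * (s:ℝ)^4 / t * ((m:ℝ)^2 / 2) ≤ e * (m * (m - 1)) / (n : ℝ) ^ 2 := by
    rw [le_div_iff₀ (by positivity)]
    have h1 : (m:ℝ)^2 / 2 ≤ m * (m - 1) := by nlinarith
    calc c' * (s:ℝ)^4 / t * ((m:ℝ)^2 / 2) * (n:ℝ)^2
        = (c' * (s:ℝ)^4 * ((n:ℝ)^2 / t)) * ((m:ℝ)^2 / 2) := by ring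
      _ ≤ e * (m * (m - 1)) := by
        have : 0 ≤ c' * (s:ℝ)^4 * ((n:ℝ)^2 / t) := by positivity
        apply mul_le_mul hedges.le h1 (by positivity) (by linarith)
  have hR : c * (s : ℝ) ^ 4 * (m : ℝ) ^ ((2 : ℝ) - ε) ≤ c' * (s:ℝ)^4 / t * ((m:ℝ)^2 / 4) := by
    calc c * (s : ℝ) ^ 4 * (m : ℝ) ^ ((2 : ℝ) - ε)
        ≤ c' * (s : ℝ) ^ 4 * ((m:ℝ)^2 / (4 * t)) := by gcongr
      _ = _ := by field_simp
  have hfin : c' * (s:ℝ)^4 / t / 4 ≤ N * ((m:ℝ)/n)^h := by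
    have : (0:ℝ) < (m:ℝ)^2 := by positivity
    refine le_of_mul_le_mul_left ?_ this
    linarith
  have hfin2 : c' * (s:ℝ)^4 / t / 4 * (n:ℝ)^h ≤ N * (m:ℝ)^h := by
    rw [div_pow, mul_div_assoc', le_div_iff₀ (by positivity)] at hfin
    exact hfin
  have htq : t ≤ (n:ℝ)^(1/4:ℝ) := by
    apply Real.rpow_le_rpow_of_exponent_le hn1
    rw [hε', div_le_iff₀ (by positivity)]; nlinarith
  have hprod : t * (m:ℝ)^h ≤ n := by
    calc t * (m:ℝ)^h ≤ (n:ℝ)^(1/4:ℝ) * (n:ℝ)^(3/4:ℝ) := by gcongr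
      _ = n := by rw [← Real.rpow_add hnR]; norm_num
  have hnp : (n:ℝ)^h = (n:ℝ)^(h-1) * n := by
    rw [← pow_succ]; congr 1; omega
  have hmhp : (0:ℝ) < t * (m:ℝ)^h := by positivity
  refine le_of_mul_le_mul_right ?_ hmhp
  calc 2 * (s:ℝ) * (n:ℝ)^(h-1) * (t * (m:ℝ)^h) ≤ 2 * (s:ℝ) * (n:ℝ)^(h-1) * n := by gcongr
    _ = 8 * (s * (n:ℝ)^h) / 4 := by rw [hnp]; ring
    _ ≤ (c' * (s:ℝ)^3) * (s * (n:ℝ)^h) / 4 := by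
        have : 8 ≤ c' * (s:ℝ)^3 := by nlinarith
        gcongr
    _ = t * (c' * (s:ℝ)^4 / t / 4 * (n:ℝ)^h) := by field_simp
    _ ≤ t * (N * (m:ℝ)^h) := by gcongr
    _ = _ := by ring

/-- Under the extremal hypothesis for `H`, with `ε' = ε/(2|H|)` and
`c' = max{|H|, c}`, every `n`-vertex `K_{s,s}`-subgraph-free graph `G` (`s ≥ 2`) with more
than `c'·s⁴·n^(2-ε')` edges contains at least `2s·n^(|H|-1)` distinct induced copies of
`H`, i.e. vertex subsets `Y` with `G[Y] ≅ H`. -/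
theorem stmt_7 {VH : Type} [Fintype VH] (H : SimpleGraph VH) (hH : H.Colorable 2)
    (hVH : 2 ≤ Fintype.card VH)
    (ε c : ℝ) (hε : 0 < ε) (hε2 : ε ≤ 1 / 2) (hc : 1 < c) (hext : ExtremalBound H ε c)
    (ε' c' : ℝ) (hε' : ε' = ε / (2 * Fintype.card VH))
    (hc' : c' = max (Fintype.card VH : ℝ) c)
    (s : ℕ) (hs : 2 ≤ s)
    {V : Type} [Fintype V] (G : SimpleGraph V) (n : ℕ) (hn : n = Fintype.card V)
    (hKss : ¬ HasSubgraphCopy G (completeBipartiteGraph (Fin s) (Fin s)))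
    (hedges : c' * (s : ℝ) ^ 4 * (n : ℝ) ^ ((2 : ℝ) - ε') < (G.edgeSet.ncard : ℝ)) :
    2 * (s : ℝ) * (n : ℝ) ^ (Fintype.card VH - 1) ≤
      (({Y : Set V | Nonempty ((G.induce Y) ≃g H)}).ncard : ℝ) := by
  classical
  have hn0 : 0 < n := by
    rcases Nat.eq_zero_or_pos n with h0 | h0
    · exfalso
      have : IsEmpty V := Fintype.card_eq_zero_iff.1 (hn ▸ h0)
      have he : G.edgeSet = ∅ := by
        ext e
        induction e with | _ x y => exact (this.false x).elim
      rw [he, Set.ncard_empty] at hedges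
      have hc0 : 0 ≤ c' := by rw [hc']; exact le_trans (by linarith) (le_max_right _ _)
      have : 0 ≤ c' * (s : ℝ) ^ 4 * (n : ℝ) ^ ((2 : ℝ) - ε') := by positivity
      simp only [Nat.cast_zero] at hedges
      linarith
    · exact h0
  have he : (G.edgeSet.ncard : ℝ) ≤ (n : ℝ) ^ 2 / 2 := by
    have h1 : G.edgeSet.ncard ≤ n.choose 2 := by
      rw [← SimpleGraph.coe_edgeFinset, Set.ncard_coe_finset, hn]
      exact SimpleGraph.card_edgeFinset_le_card_choose_two
    have h2 : (G.edgeSet.ncard : ℝ) ≤ (n.choose 2 : ℝ) := by exact_mod_cast h1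
    rw [Nat.cast_choose_two] at h2
    have : (0:ℝ) ≤ n := by positivity
    nlinarith
  refine aux_numeric (Fintype.card VH) n s hVH hs hn0 ε ε' c c' _ _ hε hε2 hc hε' hc' he hedges
    (by positivity) ?_
  intro m hm hmn
  rw [hn]
  refine aux_double H G m hm (hn ▸ hmn) _ (by positivity) ?_
  intro S hS hno
  have hcard : Fintype.card (S : Set V) = m := by simp [hS]
  have := hext s (by omega) (S : Set V) (G.induce (S : Set V)) (by omega) ?_ hno
  · rwa [hcard] at this
  · rintro ⟨f, hf⟩
    exact hKss ⟨(SimpleGraph.Embedding.induce (S : Set V)).toHom.comp f,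
      Subtype.val_injective.comp hf⟩
end

section
/- There exists a function f₁ such that the following holds. Let γ ∈ (0, 1/5) and d ≥ f₁(γ). Let G₀ be an n-vertex graph which is d-degenerate and has average degree d. Then either (A) G₀ contains an induced subgraph G* of average degree at least 6·d^{1−5γ} and maximum degree at most 6·d^{1+3γ}, or (B) there is a partition V(G₀) = A ⊔ B such that the number of edges between A and B is at least n·d/4 and |A| ≥ 2^{d^γ − 2}·|B|. -/
open SimpleGraph

/-- The 1-subdivision of a graph: every edge is subdivided exactly once. -/
def oneSubdiv {V : Type} (G : SimpleGraph V) : SimpleGraph (V ⊕ G.edgeSet) :=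
  SimpleGraph.fromRel (fun x y => ∃ (v : V) (e : G.edgeSet),
    x = Sum.inl v ∧ y = Sum.inr e ∧ v ∈ (e : Sym2 V))

/-- The number of edges of `G` with one endpoint in `A` and the other in `B`. -/
noncomputable def crossEdges {V : Type} (G : SimpleGraph V) (A B : Set V) : ℕ :=
  {e : Sym2 V | e ∈ G.edgeSet ∧ ∃ a ∈ A, ∃ b ∈ B, e = s(a, b)}.ncard

/-- `G` is `d`-degenerate: every nonempty (induced) subgraph has a vertex of degree at most `d`. -/
def Degenerate {V : Type} (G : SimpleGraph V) (d : ℝ) : Prop :=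
  ∀ s : Set V, s.Nonempty → ∃ v ∈ s, ((G.neighborSet v ∩ s).ncard : ℝ) ≤ d

/-- The maximum average degree of `G`: the maximum of the average degree over all induced
subgraphs of `G`. -/
noncomputable def maxAvgDeg {V : Type} (G : SimpleGraph V) [Fintype V] : ℝ :=
  ⨆ t : Finset V, avgDeg (G.induce (t : Set V))

noncomputable def adjR {V : Type} (G : SimpleGraph V) (u v : V) : ℝ := by
  classical exact if G.Adj u v then 1 else 0

noncomputable def ee {V : Type} (G : SimpleGraph V) (X Y : Finset V) : ℝ :=
  ∑ u ∈ X, ∑ v ∈ Y, adjR G u v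

lemma adjR_nonneg {V : Type} (G : SimpleGraph V) (u v : V) : 0 ≤ adjR G u v := by
  unfold adjR; split_ifs <;> norm_num

lemma adjR_sq {V : Type} (G : SimpleGraph V) (u v : V) : adjR G u v * adjR G u v = adjR G u v := by
  unfold adjR; split_ifs <;> norm_num

lemma adjR_comm {V : Type} (G : SimpleGraph V) (u v : V) : adjR G u v = adjR G v u := by
  by_cases h : G.Adj u v
  · simp [adjR, h, h.symm]
  · simp [adjR, h, mt SimpleGraph.Adj.symm h]

lemma adjR_self {V : Type} (G : SimpleGraph V) (u : V) : adjR G u u = 0 := by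
  unfold adjR; simp

lemma ee_nonneg {V : Type} (G : SimpleGraph V) (X Y : Finset V) : 0 ≤ ee G X Y :=
  Finset.sum_nonneg fun _ _ => Finset.sum_nonneg fun _ _ => adjR_nonneg _ _ _

lemma ee_comm {V : Type} (G : SimpleGraph V) (X Y : Finset V) : ee G X Y = ee G Y X := by
  unfold ee; rw [Finset.sum_comm]
  exact Finset.sum_congr rfl fun x _ => Finset.sum_congr rfl fun y _ => adjR_comm G y x

lemma ee_mono {V : Type} (G : SimpleGraph V) {X X' Y Y' : Finset V} (h : X ⊆ X') (h' : Y ⊆ Y') :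
    ee G X Y ≤ ee G X' Y' := by
  unfold ee
  refine (Finset.sum_le_sum fun u _ => Finset.sum_le_sum_of_subset_of_nonneg h'
    fun _ _ _ => adjR_nonneg _ _ _).trans ?_
  exact Finset.sum_le_sum_of_subset_of_nonneg h
    fun _ _ _ => Finset.sum_nonneg fun _ _ => adjR_nonneg _ _ _

lemma nbr_ncard {V : Type} (G : SimpleGraph V) (v : V) (t : Finset V) :
    ((G.neighborSet v ∩ (t : Set V)).ncard : ℝ) = ∑ u ∈ t, adjR G v u := by
  classical
  have : (G.neighborSet v ∩ (t : Set V)) = ((t.filter (fun u => G.Adj v u) : Finset V) : Set V) := by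
    ext u; simp [and_comm]
  rw [this, Set.ncard_coe_finset]
  simp [adjR]

lemma two_edges {V : Type} [Fintype V] (G : SimpleGraph V) :
    2 * (G.edgeSet.ncard : ℝ) = ee G Finset.univ Finset.univ := by
  classical
  have h := G.sum_degrees_eq_twice_card_edges
  have h1 : G.edgeSet.ncard = G.edgeFinset.card := by
    rw [← SimpleGraph.coe_edgeFinset, Set.ncard_coe_finset]
  rw [h1]
  have : ((2 * G.edgeFinset.card : ℕ) : ℝ) = ee G Finset.univ Finset.univ := by
    rw [← h]; push_cast
    unfold ee
    refine Finset.sum_congr rfl fun v _ => ?_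
    rw [← nbr_ncard, ← SimpleGraph.card_neighborFinset_eq_degree]
    simp [← Set.ncard_coe_finset]
  rw [← this]; push_cast; rfl

lemma avgDeg_eq {V : Type} [Fintype V] (G : SimpleGraph V) :
    avgDeg G = ee G Finset.univ Finset.univ / Fintype.card V := by
  unfold avgDeg; rw [two_edges]

lemma avgDeg_induce {V : Type} [Fintype V] (G : SimpleGraph V) (t : Finset V)
    [Fintype ↥(t : Set V)] :
    avgDeg (G.induce (t : Set V)) = ee G t t / t.card := by
  classical
  rw [avgDeg_eq]
  congr 1
  · unfold ee
    have key : ∀ f : V → ℝ, ∑ x : ↥(t : Set V), f x = ∑ x ∈ t, f x := fun f => by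
      exact (Finset.sum_subtype t (fun x => (Finset.mem_coe).symm) f).symm
    rw [← key]
    refine Finset.sum_congr rfl fun x _ => ?_
    rw [← key]
    refine Finset.sum_congr rfl fun y _ => ?_
    simp [adjR]
  · simp

lemma ee_le_cross {V : Type} [Fintype V] (G : SimpleGraph V) (A B : Finset V)
    (hd : Disjoint A B) : ee G A B ≤ crossEdges G (A : Set V) (B : Set V) := by
  classical
  have h1 : ee G A B = (((A ×ˢ B).filter (fun q => G.Adj q.1 q.2)).card : ℝ) := by
    unfold ee adjR
    rw [← Finset.sum_product']
    simp
  rw [h1]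
  unfold crossEdges
  norm_cast
  rw [← Set.ncard_coe_finset]
  refine Set.ncard_le_ncard_of_injOn (fun q => s(q.1, q.2)) ?_ ?_ (Set.toFinite _)
  · rintro ⟨a, b⟩ h
    simp only [Finset.coe_filter, Finset.mem_product, Set.mem_ofPred_eq] at h
    exact ⟨h.2, a, h.1.1, b, h.1.2, rfl⟩
  · rintro ⟨a, b⟩ h ⟨a', b'⟩ h' e
    simp only [Finset.coe_filter, Finset.mem_product, Set.mem_ofPred_eq] at h h'
    simp only [Sym2.eq_iff] at e
    rcases e with ⟨e1, e2⟩ | ⟨e1, e2⟩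
    · simp [e1, e2]
    · exact absurd (e1 ▸ h.1.1) (fun hh => Finset.disjoint_left.1 hd hh h'.1.2)

lemma degen_bound {V : Type} (G : SimpleGraph V) (d : ℝ) (hG : Degenerate G d) (U : Finset V) :
    ee G U U ≤ 2 * d * U.card := by
  classical
  induction hn : U.card generalizing U with
  | zero => rw [Finset.card_eq_zero] at hn; subst hn; simp [ee]
  | succ n ih =>
    have hne : U.Nonempty := by rw [← Finset.card_pos]; omega
    obtain ⟨v, hv, hvd⟩ := hG (U : Set V) (by simpa using hne)
    rw [nbr_ncard] at hvd
    have hv' : v ∈ U := by simpa using hv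
    have h := ih (U.erase v) (by rw [Finset.card_erase_of_mem hv']; omega)
    have e1 : ee G U U = ee G (U.erase v) (U.erase v) + 2 * ∑ u ∈ U, adjR G v u := by
      unfold ee
      have a1 : ∀ f : V → ℝ, ∑ u ∈ U, f u = f v + ∑ u ∈ U.erase v, f u := fun f =>
        (Finset.add_sum_erase U f hv').symm
      rw [a1 (fun u => ∑ w ∈ U, adjR G u w)]
      have a2 : ∑ u ∈ U.erase v, ∑ w ∈ U, adjR G u w
          = ∑ u ∈ U.erase v, adjR G v u + ∑ u ∈ U.erase v, ∑ w ∈ U.erase v, adjR G u w := by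
        rw [← Finset.sum_add_distrib]
        refine Finset.sum_congr rfl fun u _ => ?_
        rw [a1 (fun w => adjR G u w), adjR_comm]
      rw [a2, a1 (fun w => adjR G v w), adjR_self]; ring
    rw [e1]; push_cast; linarith

/-- conditional expectations for a quadratic functional -/
lemma exists_sampling {V : Type} [DecidableEq V] (p : ℝ) (hp0 : 0 ≤ p) (hp1 : p ≤ 1) (b : V → V → ℝ)
    (hb : ∀ u v, 0 ≤ b u v) (A : Finset V) : ∀ a : V → ℝ, ∃ S ⊆ A,
      p * ∑ u ∈ A, a u - p * ∑ u ∈ A, b u u - p ^ 2 * ∑ u ∈ A, ∑ v ∈ A, b u v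
        ≤ ∑ u ∈ S, a u - ∑ u ∈ S, ∑ v ∈ S, b u v := by
  induction A using Finset.induction_on with
  | empty => intro a; exact ⟨∅, by simp, by simp⟩
  | insert w A hw ih =>
    intro a
    obtain ⟨S1, h1, i1⟩ := ih (fun u => a u - b u w - b w u)
    obtain ⟨S2, h2, i2⟩ := ih a
    have hwS1 : w ∉ S1 := fun h => hw (h1 h)
    by_contra! hcon
    have c1 := hcon (insert w S1) (Finset.insert_subset_insert w h1)
    have c2 := hcon S2 (h2.trans (Finset.subset_insert w A))
    have dbl : ∀ X : Finset V, w ∉ X → ∑ u ∈ insert w X, ∑ v ∈ insert w X, b u v =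
        b w w + ∑ v ∈ X, b w v + ∑ u ∈ X, b u w + ∑ u ∈ X, ∑ v ∈ X, b u v := by
      intro X hX
      rw [Finset.sum_insert hX, Finset.sum_insert hX]
      have : ∑ u ∈ X, ∑ v ∈ insert w X, b u v = ∑ u ∈ X, b u w + ∑ u ∈ X, ∑ v ∈ X, b u v := by
        rw [← Finset.sum_add_distrib]
        exact Finset.sum_congr rfl fun u _ => Finset.sum_insert hX
      rw [this]; ring
    rw [dbl A hw, Finset.sum_insert hw, Finset.sum_insert hw] at c1 c2
    rw [dbl S1 hwS1, Finset.sum_insert hwS1] at c1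
    simp only [Finset.sum_sub_distrib] at i1
    have hbw := hb w w
    generalize ∑ u ∈ A, ∑ v ∈ A, b u v = q at *
    generalize ∑ u ∈ A, b u u = q1 at *
    generalize ∑ u ∈ A, b u w = q2 at *
    generalize ∑ u ∈ A, b w u = q3 at *
    generalize ∑ u ∈ A, a u = q4 at *
    have j1 := lt_of_lt_of_le' c1 (le_refl _)
    have k1 : p * (q4 - q2 - q3) - p * q1 - p ^ 2 * q + a w - b w w <
      p * (a w + q4) - p * (b w w + q1) - p ^ 2 * (b w w + q3 + q2 + q) := by linarith
    have k2 : p * q4 - p * q1 - p ^ 2 * q <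
      p * (a w + q4) - p * (b w w + q1) - p ^ 2 * (b w w + q3 + q2 + q) := by linarith
    rcases eq_or_lt_of_le hp0 with h0 | h0
    · subst h0; norm_num at k2
    · have m1 := mul_lt_mul_of_pos_left k1 h0
      have m2 := mul_le_mul_of_nonneg_left k2.le (sub_nonneg.2 hp1)
      have : 0 ≤ p ^ 2 * b w w := by positivity
      nlinarith

lemma extract {V : Type} [DecidableEq V] (G : SimpleGraph V) (X Y : Finset V) (p n d x : ℝ)
    (hd : 1 ≤ d) (hx : 1000 ≤ x) (hp0 : 0 < p) (hp1 : p ≤ 1) (hn : 0 < n)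
    (hX : (X.card : ℝ) ≤ n) (hY : (Y.card : ℝ) ≤ n * p)
    (hdeg : ∀ v ∈ Y, p * ∑ u ∈ X, adjR G v u ≤ 2 * d)
    (hXd : ∀ u ∈ X, ∀ Z : Finset V, ∑ v ∈ Z, adjR G u v ≤ 6 * (d * x ^ 3))
    (hYd : ∀ v ∈ Y, ∑ u ∈ Y, adjR G v u ≤ d * x ^ 3)
    (hW : n * d / (8 * x ^ 2) ≤ ee G X Y) :
    ∃ t : Finset V, 0 < t.card ∧ 6 * (d / x ^ 5) * t.card ≤ ee G t t ∧
      ∀ v ∈ t, ∑ u ∈ t, adjR G v u ≤ 6 * (d * x ^ 3) := by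
  have hx0 : 0 < x := by linarith
  have hd0 : 0 < d := by linarith
  set T := d * x ^ 3 with hT
  have hT0 : 0 < T := by positivity
  set l := 6 * (d / x ^ 5) with hl
  have hl0 : 0 < l := by positivity
  obtain ⟨S, hS, hF⟩ := exists_sampling p hp0.le hp1
    (fun u w => (∑ v ∈ Y, adjR G v u * adjR G v w) / T)
    (fun u w => div_nonneg (Finset.sum_nonneg fun _ _ =>
      mul_nonneg (adjR_nonneg _ _ _) (adjR_nonneg _ _ _)) hT0.le) X
    (fun u => ∑ v ∈ Y, adjR G u v - l)
  have ha : ∀ Z : Finset V, ∑ u ∈ Z, (∑ v ∈ Y, adjR G u v - l) = ee G Z Y - l * Z.card := by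
    intro Z
    rw [Finset.sum_sub_distrib]; simp [ee, mul_comm]
  have hb2 : ∀ Z : Finset V, ∑ u ∈ Z, ∑ w ∈ Z, (∑ v ∈ Y, adjR G v u * adjR G v w) / T
      = (∑ v ∈ Y, (∑ u ∈ Z, adjR G v u) ^ 2) / T := by
    intro Z
    simp only [← Finset.sum_div]
    congr 1
    simp only [sq, Finset.sum_mul_sum]
    rw [Finset.sum_comm (s := Y) (t := Z)]
    exact Finset.sum_congr rfl fun u _ => Finset.sum_comm
  have hb1 : ∑ u ∈ X, (∑ v ∈ Y, adjR G v u * adjR G v u) / T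
      = (∑ v ∈ Y, ∑ u ∈ X, adjR G v u) / T := by
    simp only [← Finset.sum_div, adjR_sq]
    rw [Finset.sum_comm]
  simp only [ha, hb2, hb1] at hF
  have e1 : p * ((∑ v ∈ Y, ∑ u ∈ X, adjR G v u) / T) ≤ n * p * (2 * d) / T := by
    rw [← mul_div_assoc, Finset.mul_sum]
    gcongr
    calc _ ≤ ∑ v ∈ Y, 2 * d := Finset.sum_le_sum hdeg
      _ = Y.card * (2 * d) := by simp
      _ ≤ _ := by gcongr
  have e2 : p ^ 2 * ((∑ v ∈ Y, (∑ u ∈ X, adjR G v u) ^ 2) / T) ≤ n * p * (4 * d ^ 2) / T := by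
    rw [← mul_div_assoc, Finset.mul_sum]
    gcongr
    calc _ ≤ ∑ v ∈ Y, 4 * d ^ 2 := by
            refine Finset.sum_le_sum fun v hv => ?_
            have h1 := hdeg v hv
            have h0 : 0 ≤ p * ∑ u ∈ X, adjR G v u :=
              mul_nonneg hp0.le (Finset.sum_nonneg fun _ _ => adjR_nonneg _ _ _)
            nlinarith
      _ = Y.card * (4 * d ^ 2) := by simp
      _ ≤ _ := by gcongr
  have e3 : p * (n * d / (8 * x ^ 2) - l * n) ≤ p * (ee G X Y - l * X.card) := by gcongr
  have e4 : l * Y.card ≤ l * (n * p) := by gcongr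
  have num : 0 < p * (n * d / (8 * x ^ 2) - l * n) - n * p * (2 * d) / T
      - n * p * (4 * d ^ 2) / T - l * (n * p) := by
    have : p * (n * d / (8 * x ^ 2) - l * n) - n * p * (2 * d) / T
      - n * p * (4 * d ^ 2) / T - l * (n * p)
      = p * n * (d * x ^ 3 - 16 * x ^ 2 - 32 * d * x ^ 2 - 96 * d) / (8 * x ^ 5) := by
      rw [hl, hT]; field_simp; ring
    rw [this]
    have : 0 < d * x ^ 3 - 16 * x ^ 2 - 32 * d * x ^ 2 - 96 * d := by
      have h1 : d * x ^ 2 * 1000 ≤ d * x ^ 3 := by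
        have : d * x ^ 3 = d * x ^ 2 * x := by ring
        rw [this]; gcongr
      have h2 : x ^ 2 ≤ d * x ^ 2 := by nlinarith [sq_nonneg x]
      have h3 : d * 1 ≤ d * x ^ 2 := by gcongr; nlinarith
      have : 0 < d * x ^ 2 := by positivity
      linarith
    positivity
  set Y' := Y.filter (fun v => ∑ u ∈ S, adjR G v u ≤ T) with hY'
  have e5 : ee G S Y - (∑ v ∈ Y, (∑ u ∈ S, adjR G v u) ^ 2) / T ≤ ee G S Y' := by
    rw [ee_comm G S Y, ee_comm G S Y']
    unfold ee
    rw [hY', Finset.sum_filter, Finset.sum_div, ← Finset.sum_sub_distrib]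
    refine Finset.sum_le_sum fun v _ => ?_
    split_ifs with h
    · have : 0 ≤ (∑ u ∈ S, adjR G v u) ^ 2 / T := by positivity
      linarith
    · push Not at h
      rw [sub_nonpos, le_div_iff₀ hT0, sq]
      have : 0 ≤ ∑ u ∈ S, adjR G v u := hT0.le.trans h.le
      gcongr
  have e6 : l * ((S ∪ Y').card : ℝ) ≤ l * S.card + l * Y.card := by
    rw [← mul_add]
    gcongr
    have : (S ∪ Y').card ≤ S.card + Y.card :=
      (Finset.card_union_le _ _).trans (by gcongr; exact Finset.filter_subset _ _)
    exact_mod_cast this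
  have e7 : ee G S Y' ≤ ee G (S ∪ Y') (S ∪ Y') :=
    ee_mono G Finset.subset_union_left Finset.subset_union_right
  have e8 : l * ((S ∪ Y').card : ℝ) < ee G (S ∪ Y') (S ∪ Y') := by linarith
  refine ⟨S ∪ Y', ?_, e8.le, ?_⟩
  · by_contra h
    have : S ∪ Y' = ∅ := by simpa using h
    rw [this] at e8; simp [ee] at e8
  · intro v hv
    rcases Finset.mem_union.1 hv with h | h
    · exact hXd v (hS h) _
    · rw [hY', Finset.mem_filter] at h
      have h1 := hYd v h.1
      have h2 : ∑ u ∈ Y', adjR G v u ≤ ∑ u ∈ Y, adjR G v u :=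
        Finset.sum_le_sum_of_subset_of_nonneg (Finset.filter_subset _ _)
          fun _ _ _ => adjR_nonneg _ _ _
      have h3 : ∑ u ∈ S ∪ Y', adjR G v u ≤ ∑ u ∈ S, adjR G v u + ∑ u ∈ Y', adjR G v u := by
        rw [← Finset.sum_union_inter]
        have : 0 ≤ ∑ u ∈ S ∩ Y', adjR G v u := Finset.sum_nonneg fun _ _ => adjR_nonneg _ _ _
        linarith
      linarith [h.2]

lemma pair {V : Type} [Fintype V] [DecidableEq V] (G : SimpleGraph V) (X Y : Finset V) (n d x : ℝ)
    (hG : Degenerate G d) (i j : ℕ) (hij : i ≤ j)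
    (hd : 1 ≤ d) (hx : 1000 ≤ x) (hn : 0 < n)
    (hX : (X.card : ℝ) * 2 ^ i ≤ n) (hY : (Y.card : ℝ) * 2 ^ j ≤ n)
    (hXd : ∀ u ∈ X, ∑ v, adjR G u v ≤ 2 ^ (i + 1) * d)
    (hYd : ∀ u ∈ Y, ∑ v, adjR G u v ≤ 2 ^ (j + 1) * d)
    (hW : n * d / (4 * x ^ 2) ≤ ee G X Y) :
    ∃ t : Finset V, 0 < t.card ∧ 6 * (d / x ^ 5) * t.card ≤ ee G t t ∧
      ∀ v ∈ t, ∑ u ∈ t, adjR G v u ≤ 6 * (d * x ^ 3) := by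
  have hx0 : 0 < x := by linarith
  have hd0 : 0 < d := by linarith
  have hsub : ∀ (v : V) (Z : Finset V), ∑ u ∈ Z, adjR G v u ≤ ∑ u, adjR G v u := fun v Z =>
    Finset.sum_le_sum_of_subset_of_nonneg (Finset.subset_univ _) fun _ _ _ => adjR_nonneg _ _ _
  have hi : (2 : ℝ) ^ i ≤ 16 * x ^ 2 := by
    have h1 : ee G X Y ≤ 2 * d * (X ∪ Y).card :=
      (ee_mono G Finset.subset_union_left Finset.subset_union_right).trans (degen_bound G d hG _)
    have h2 : ((X ∪ Y).card : ℝ) ≤ X.card + Y.card := by exact_mod_cast Finset.card_union_le _ _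
    have h3 : (Y.card : ℝ) * 2 ^ i ≤ n := by
      refine le_trans ?_ hY
      gcongr; norm_num
    have h4 : n * d / (4 * x ^ 2) ≤ 2 * d * (X.card + Y.card) :=
      (hW.trans h1).trans (by gcongr)
    rw [div_le_iff₀ (by positivity)] at h4
    have h5 : n * d * 2 ^ i ≤ n * d * (16 * x ^ 2) := by
      calc n * d * 2 ^ i ≤ 2 * d * (X.card + Y.card) * (4 * x ^ 2) * 2 ^ i := by gcongr
        _ = 8 * d * x ^ 2 * (X.card * 2 ^ i + Y.card * 2 ^ i) := by ring
        _ ≤ 8 * d * x ^ 2 * (n + n) := by gcongr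
        _ = _ := by ring
    exact le_of_mul_le_mul_left h5 (by positivity)
  set Y' := Y.filter (fun v => ∑ u ∈ Y, adjR G v u ≤ d * x ^ 3) with hY'
  set R := Y.filter (fun v => ¬ ∑ u ∈ Y, adjR G v u ≤ d * x ^ 3) with hR
  have hR1 : (R.card : ℝ) * (d * x ^ 3) ≤ 2 * d * Y.card := by
    refine le_trans ?_ (degen_bound G d hG Y)
    refine le_trans ?_ (ee_mono G (Finset.filter_subset _ _ : R ⊆ Y) (le_refl Y))
    unfold ee
    rw [← nsmul_eq_mul]
    refine Finset.card_nsmul_le_sum _ _ _ fun v hv => ?_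
    rw [hR, Finset.mem_filter] at hv
    exact (not_le.1 hv.2).le
  have hsplit : ee G X Y = ee G X Y' + ee G X R := by
    rw [ee_comm G X Y, ee_comm G X Y', ee_comm G X R]
    exact (Finset.sum_filter_add_sum_filter_not Y _ _).symm
  have hXR : ee G X R ≤ R.card * (2 ^ (j + 1) * d) := by
    rw [ee_comm]
    unfold ee
    rw [← nsmul_eq_mul]
    refine Finset.sum_le_card_nsmul _ _ _ fun v hv => ?_
    exact (hsub v X).trans (hYd v (Finset.mem_filter.1 hv).1)
  have hXR2 : ee G X R ≤ n * d / (8 * x ^ 2) := by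
    rw [le_div_iff₀ (by positivity)]
    have h1 : (R.card : ℝ) * x ^ 3 ≤ 2 * Y.card := by
      refine le_of_mul_le_mul_left ?_ hd0
      linarith
    have h2 : (R.card : ℝ) * x ^ 3 * 2 ^ j ≤ 2 * n := by
      calc _ ≤ 2 * Y.card * (2 : ℝ) ^ j := by gcongr
        _ ≤ _ := by linarith
    have h3 : (R.card : ℝ) * x ^ 2 * 2 ^ j * 1000 ≤ 2 * n := by
      refine le_trans ?_ h2
      have : (R.card : ℝ) * x ^ 3 * 2 ^ j = (R.card : ℝ) * x ^ 2 * 2 ^ j * x := by ring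
      rw [this]; gcongr
    calc _ ≤ R.card * (2 ^ (j + 1) * d) * (8 * x ^ 2) := by gcongr
      _ = (R.card * x ^ 2 * 2 ^ j) * 16 * d := by ring
      _ ≤ n * d := by gcongr; linarith
  have h2j : (0 : ℝ) < 2 ^ j := by positivity
  have h1j : (1 : ℝ) ≤ 2 ^ j := one_le_pow₀ (by norm_num)
  refine extract G X Y' (1 / 2 ^ j) n d x hd hx (by positivity) ?_ hn ?_ ?_ ?_ ?_ ?_ ?_
  · rw [div_le_one h2j]; exact h1j
  · refine le_trans ?_ hX
    exact le_mul_of_one_le_right (by positivity) (one_le_pow₀ (by norm_num))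
  · rw [mul_one_div, le_div_iff₀ h2j]
    refine le_trans ?_ hY
    gcongr; exact Finset.filter_subset _ _
  · intro v hv
    have := (hsub v X).trans (hYd v (Finset.mem_filter.1 hv).1)
    rw [one_div_mul_eq_div, div_le_iff₀ h2j]
    rw [pow_succ] at this; linarith
  · intro u hu Z
    refine (hsub u Z).trans ((hXd u hu).trans ?_)
    calc (2 : ℝ) ^ (i + 1) * d = 2 ^ i * (2 * d) := by ring
      _ ≤ 16 * x ^ 2 * (2 * d) := by gcongr
      _ = d * x ^ 2 * 32 := by ring
      _ ≤ d * x ^ 2 * (6 * x) := by gcongr; linarith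
      _ = _ := by ring
  · intro v hv
    rw [hY', Finset.mem_filter] at hv
    exact (Finset.sum_le_sum_of_subset_of_nonneg (Finset.filter_subset _ _)
          fun _ _ _ => adjR_nonneg _ _ _).trans hv.2
  · have : n * d / (4 * x ^ 2) = n * d / (8 * x ^ 2) + n * d / (8 * x ^ 2) := by
      field_simp; ring
    linarith

lemma core {V : Type} [Fintype V] [DecidableEq V] (G : SimpleGraph V) (n d x : ℝ)
    (hG : Degenerate G d) (hn' : n = Fintype.card V) (hn : 0 < n)
    (hd : 1 ≤ d) (hx : 1000 ≤ x) (htot : ee G Finset.univ Finset.univ = n * d) :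
    (∃ t : Finset V, 0 < t.card ∧ 6 * (d / x ^ 5) * t.card ≤ ee G t t ∧
      ∀ v ∈ t, ∑ u ∈ t, adjR G v u ≤ 6 * (d * x ^ 3)) ∨
    (∃ A B : Finset V, A ∪ B = Finset.univ ∧ Disjoint A B ∧ n * d / 4 ≤ ee G A B ∧
      (2 : ℝ) ^ (x - 2) * B.card ≤ A.card) := by
  have hx0 : 0 < x := by linarith
  have hd0 : 0 < d := by linarith
  set L := ⌊x⌋₊ with hL
  have hLx : (L : ℝ) ≤ x := Nat.floor_le hx0.le
  have hLx' : x < L + 1 := Nat.lt_floor_add_one x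
  have hL3 : 3 ≤ L := Nat.le_floor (by norm_num; linarith)
  set D : V → ℝ := fun v => ∑ u, adjR G v u with hD
  have hD0 : ∀ v, 0 ≤ D v := fun v => Finset.sum_nonneg fun _ _ => adjR_nonneg _ _ _
  have hDtot : ∑ v, D v = n * d := htot
  have markov : ∀ (k : ℕ) (Z : Finset V), (∀ v ∈ Z, 2 ^ k * d ≤ D v) →
      (Z.card : ℝ) * 2 ^ k ≤ n := by
    intro k Z hZ
    have h1 : (Z.card : ℝ) * (2 ^ k * d) ≤ n * d := by
      rw [← hDtot, ← nsmul_eq_mul]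
      refine (Finset.card_nsmul_le_sum _ _ _ hZ).trans ?_
      exact Finset.sum_le_sum_of_subset_of_nonneg (Finset.subset_univ _) fun v _ _ => hD0 v
    refine le_of_mul_le_mul_right ?_ hd0
    linarith
  set A := Finset.univ.filter (fun v => ¬ 2 ^ L * d ≤ D v) with hA
  set B := Finset.univ.filter (fun v => 2 ^ L * d ≤ D v) with hB
  have hAB : A ∪ B = Finset.univ := by
    rw [Finset.union_comm]; exact Finset.filter_union_filter_not_eq _ _
  have hdis : Disjoint A B := (Finset.disjoint_filter_filter_not _ _ _).symm
  have hBn : (B.card : ℝ) * 2 ^ L ≤ n := markov L B fun v hv => (Finset.mem_filter.1 hv).2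
  have hcard : (A.card : ℝ) + B.card = n := by
    rw [hn', ← Finset.card_univ, ← hAB, Finset.card_union_of_disjoint hdis]; push_cast; ring
  by_cases hcross : n * d / 4 ≤ ee G A B
  · right
    refine ⟨A, B, hAB, hdis, hcross, ?_⟩
    have h1 : (2 : ℝ) ^ (x - 2) ≤ 2 ^ (L - 1) := by
      rw [← Real.rpow_natCast]
      refine Real.rpow_le_rpow_of_exponent_le (by norm_num) ?_
      rw [Nat.cast_sub (by omega)]; push_cast; linarith
    have h2 : (2 : ℝ) ^ L = 2 * 2 ^ (L - 1) := by
      rw [← pow_succ']; congr 1; omega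
    have h3 : (1 : ℝ) ≤ 2 ^ (L - 1) := one_le_pow₀ (by norm_num)
    have h4 : (B.card : ℝ) * 1 ≤ B.card * 2 ^ (L - 1) := by gcongr
    have h5 : (2 : ℝ) ^ (x - 2) * B.card ≤ 2 ^ (L - 1) * B.card := by gcongr
    rw [h2] at hBn
    linarith
  · left
    push Not at hcross
    have hunion : ee G Finset.univ Finset.univ = ee G A A + 2 * ee G A B + ee G B B := by
      have a1 : ∀ f : V → ℝ, ∑ u, f u = ∑ u ∈ A, f u + ∑ u ∈ B, f u := fun f => by
        rw [← hAB, Finset.sum_union hdis]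
      have h1 : ee G Finset.univ Finset.univ = ee G A A + ee G A B + (ee G B A + ee G B B) := by
        unfold ee
        rw [a1, ← Finset.sum_add_distrib, ← Finset.sum_add_distrib]
        simp only [a1]
      rw [h1, ee_comm G B A]; ring
    have hBB : ee G B B ≤ n * d / 4 := by
      have h1 := degen_bound G d hG B
      have h2 : (8 : ℝ) ≤ 2 ^ L := by
        calc (8 : ℝ) = 2 ^ 3 := by norm_num
          _ ≤ 2 ^ L := pow_le_pow_right₀ (by norm_num) hL3
      have h3 : (B.card : ℝ) * 8 ≤ n := le_trans (by gcongr) hBn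
      nlinarith
    have hAA : n * d / 4 < ee G A A := by linarith
    set c : V → ℕ := fun v => Nat.log 2 ⌊D v / d⌋₊ with hc
    have hcL : ∀ v ∈ A, c v ∈ Finset.range L := by
      intro v hv
      have h1 := not_le.1 (Finset.mem_filter.1 hv).2
      rw [Finset.mem_range]
      refine Nat.log_lt_of_lt_pow' (by omega) ?_
      rw [Nat.floor_lt (div_nonneg (hD0 v) hd0.le), div_lt_iff₀ hd0]
      push_cast; exact h1
    have hup : ∀ v, D v ≤ 2 ^ (c v + 1) * d := by
      intro v
      have h1 : ⌊D v / d⌋₊ < 2 ^ (c v + 1) := Nat.lt_pow_succ_log_self (by norm_num) _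
      rw [Nat.floor_lt (div_nonneg (hD0 v) hd0.le), div_lt_iff₀ hd0] at h1
      push_cast at h1; exact h1.le
    set C : ℕ → Finset V := fun i => A.filter (fun v => c v = i) with hC
    have hCcard : ∀ i, ((C i).card : ℝ) * 2 ^ i ≤ n := by
      intro i
      rcases Nat.eq_zero_or_pos i with h0 | h0
      · subst h0
        rw [hn', pow_zero, mul_one]; exact_mod_cast Finset.card_le_univ _
      · refine markov i _ fun v hv => ?_
        have hv2 : c v = i := (Finset.mem_filter.1 hv).2
        have hne : ⌊D v / d⌋₊ ≠ 0 := by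
          intro h
          simp only [hc, h, Nat.log_zero_right] at hv2; omega
        have h1 : 2 ^ i ≤ ⌊D v / d⌋₊ := by
          rw [← hv2]; exact Nat.pow_log_le_self 2 hne
        rw [Nat.le_floor_iff (div_nonneg (hD0 v) hd0.le), le_div_iff₀ hd0] at h1
        push_cast at h1; exact h1
    have hCdeg : ∀ i, ∀ u ∈ C i, ∑ v, adjR G u v ≤ 2 ^ (i + 1) * d := by
      intro i u hu
      have := hup u
      rwa [(Finset.mem_filter.1 hu).2] at this
    have hdecomp : ee G A A = ∑ i ∈ Finset.range L, ∑ j ∈ Finset.range L, ee G (C i) (C j) := by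
      have a1 : ∀ f : V → ℝ, ∑ u ∈ A, f u = ∑ i ∈ Finset.range L, ∑ u ∈ C i, f u := fun f =>
        (Finset.sum_fiberwise_of_maps_to hcL f).symm
      unfold ee
      rw [a1]
      refine Finset.sum_congr rfl fun i _ => ?_
      rw [Finset.sum_comm, a1]
      exact Finset.sum_congr rfl fun j _ => Finset.sum_comm
    have hex : ∃ i j, n * d / (4 * x ^ 2) ≤ ee G (C i) (C j) := by
      by_contra! hcon
      have h1 : ee G A A ≤ L * (L * (n * d / (4 * x ^ 2))) := by
        rw [hdecomp]
        calc _ ≤ ∑ i ∈ Finset.range L, ∑ j ∈ Finset.range L, n * d / (4 * x ^ 2) :=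
              Finset.sum_le_sum fun i _ => Finset.sum_le_sum fun j _ => (hcon i j).le
          _ = _ := by simp
      have h2 : (L : ℝ) * (L * (n * d / (4 * x ^ 2))) ≤ x * (x * (n * d / (4 * x ^ 2))) := by
        gcongr
      have h3 : x * (x * (n * d / (4 * x ^ 2))) = n * d / 4 := by field_simp
      linarith
    obtain ⟨i, j, hij⟩ := hex
    rcases le_total i j with h | h
    · exact pair G (C i) (C j) n d x hG i j h hd hx hn (hCcard i) (hCcard j) (hCdeg i) (hCdeg j) hij
    · rw [ee_comm] at hij
      exact pair G (C j) (C i) n d x hG j i h hd hx hn (hCcard j) (hCcard i) (hCdeg j) (hCdeg i) hij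

/-- There is a function `f₁` so that for every `γ ∈ (0, 1/5)` and
`d ≥ f₁(γ)`, every `n`-vertex `d`-degenerate graph `G₀` of average degree `d` contains
(A) an induced subgraph of average degree at least `6d^(1-5γ)` and maximum degree at most
`6d^(1+3γ)`, or (B) admits a partition `V(G₀) = A ⊔ B` with `e(A,B) ≥ nd/4` and
`|A| ≥ 2^(d^γ - 2)·|B|`. -/
theorem stmt_8 :
    ∃ f₁ : ℝ → ℝ, ∀ γ : ℝ, 0 < γ → γ < 1 / 5 → ∀ d : ℝ, f₁ γ ≤ d →
      ∀ (V : Type) [Fintype V], ∀ G₀ : SimpleGraph V,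
        Degenerate G₀ d → avgDeg G₀ = d →
        (∃ t : Finset V,
            6 * d ^ ((1 : ℝ) - 5 * γ) ≤ avgDeg (G₀.induce (t : Set V)) ∧
            ∀ v ∈ t, ((G₀.neighborSet v ∩ (t : Set V)).ncard : ℝ) ≤ 6 * d ^ ((1 : ℝ) + 3 * γ)) ∨
        (∃ A B : Set V, A ∪ B = Set.univ ∧ Disjoint A B ∧
            (Fintype.card V : ℝ) * d / 4 ≤ (crossEdges G₀ A B : ℝ) ∧
            (2 : ℝ) ^ (d ^ γ - 2) * (B.ncard : ℝ) ≤ (A.ncard : ℝ)) := by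
  classical
  refine ⟨fun γ => (1000 : ℝ) ^ (1 / γ), ?_⟩
  intro γ hγ _ d hd V _ G₀ hdeg havg
  have hd1 : 1 ≤ d := le_trans (Real.one_le_rpow (by norm_num) (by positivity)) hd
  have hd0 : 0 < d := by linarith
  have hx : 1000 ≤ d ^ γ := by
    have h := Real.rpow_le_rpow (by positivity) hd hγ.le
    rwa [← Real.rpow_mul (by norm_num), one_div_mul_cancel hγ.ne', Real.rpow_one] at h
  have hn : 0 < (Fintype.card V : ℝ) := by
    rcases Nat.eq_zero_or_pos (Fintype.card V) with h | h
    · rw [avgDeg, h] at havg; simp at havg; linarith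
    · exact_mod_cast h
  have htot : ee G₀ Finset.univ Finset.univ = Fintype.card V * d := by
    rw [avgDeg_eq, div_eq_iff hn.ne'] at havg; linarith
  have p5 : d ^ ((1 : ℝ) - 5 * γ) = d / (d ^ γ) ^ 5 := by
    rw [Real.rpow_sub hd0, Real.rpow_one, ← Real.rpow_natCast, ← Real.rpow_mul hd0.le]
    norm_num [mul_comm]
  have p3 : d ^ ((1 : ℝ) + 3 * γ) = d * (d ^ γ) ^ 3 := by
    rw [Real.rpow_add hd0, Real.rpow_one, ← Real.rpow_natCast, ← Real.rpow_mul hd0.le]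
    norm_num [mul_comm]
  rw [p5, p3]
  rcases core G₀ _ d (d ^ γ) hdeg rfl hn hd1 hx htot with ⟨t, ht0, ht1, ht2⟩ | ⟨A, B, h1, h2, h3, h4⟩
  · left
    refine ⟨t, ?_, ?_⟩
    · rw [avgDeg_induce, le_div_iff₀ (by exact_mod_cast ht0)]
      exact ht1
    · intro v hv
      rw [nbr_ncard]; exact ht2 v hv
  · right
    refine ⟨A, B, ?_, ?_, ?_, ?_⟩
    · rw [← Finset.coe_union, h1, Finset.coe_univ]
    · exact Finset.disjoint_coe.2 h2
    · exact h3.trans (ee_le_cross G₀ A B h2)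
    · rw [Set.ncard_coe_finset, Set.ncard_coe_finset]; exact h4
end

section
/- Let H be a bipartite graph and let 0 < ε ≤ 1/2 and c > 1 be constants such that for every integer s ≥ 1 and every n, every n-vertex graph with no K_{s,s} subgraph and no induced subgraph isomorphic to H has at most c·s^4·n^{2−ε} edges. Then there exists a polynomial P such that the following holds: for every integer s ≥ 2 and every Δ ≥ P(s), if G is a graph with no K_{s,s} subgraph and no induced subgraph isomorphic to H, with maximum degree at most Δ and average degree at least Δ^{1−ε/10}, then G has an induced subgraph G' of girth at least five with average degree at least (1/2)·Δ^{ε/10}. -/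
open SimpleGraph

open Finset in
open Classical in
/-- number of ordered adjacent pairs inside `A` -/
noncomputable def opn {V : Type} [Fintype V] (G : SimpleGraph V) (A : Finset V) : ℕ :=
  ((univ : Finset (V × V)).filter (fun x => G.Adj x.1 x.2 ∧ x.1 ∈ A ∧ x.2 ∈ A)).card

open Classical in
theorem pairs_eq {W : Type} [Fintype W] (G : SimpleGraph W) :
    ((Finset.univ : Finset (W × W)).filter (fun x => G.Adj x.1 x.2)).card
      = 2 * G.edgeSet.ncard := by
  have h1 := G.sum_degrees_eq_twice_card_edges
  rw [← SimpleGraph.coe_edgeFinset, Set.ncard_coe_finset, ← h1, Finset.card_filter,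
    Fintype.sum_prod_type]
  refine Finset.sum_congr rfl fun v _ => ?_
  rw [← Finset.card_filter, ← SimpleGraph.card_neighborFinset_eq_degree]
  congr 1
  ext w
  simp

open Classical in
theorem opn_eq {V : Type} [Fintype V] (G : SimpleGraph V) (A : Finset V) :
    opn G A = 2 * (G.induce (A : Set V)).edgeSet.ncard := by
  rw [← pairs_eq]
  unfold opn
  symm
  refine Finset.card_bij (fun x _ => (x.1.1, x.2.1)) ?_ ?_ ?_
  · intro x hx
    simp at hx ⊢
    exact hx
  · rintro ⟨⟨a, ha⟩, ⟨b, hb⟩⟩ _ ⟨⟨a', ha'⟩, ⟨b', hb'⟩⟩ _ h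
    simpa using h
  · rintro ⟨a, b⟩ h
    simp at h
    exact ⟨(⟨a, h.2.1⟩, ⟨b, h.2.2⟩), by simpa using h.1, rfl⟩

theorem opn_le {VH : Type} {H : SimpleGraph VH} {ε c : ℝ} (hε2 : ε ≤ 1 / 2) (hc : 1 < c)
    (hext : ExtremalBound H ε c) {s : ℕ} (hs : 2 ≤ s) {V : Type} [Fintype V] {G : SimpleGraph V}
    (h1 : ¬ HasSubgraphCopy G (completeBipartiteGraph (Fin s) (Fin s)))
    (h2 : ¬ HasInducedCopy G H) (A : Finset V) (M : ℝ) (hM : (A.card : ℝ) ≤ M) :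
    (opn G A : ℝ) ≤ 2 * (c * (s : ℝ) ^ 4 * M ^ ((2 : ℝ) - ε)) := by
  classical
  have hM0 : 0 ≤ M := le_trans (Nat.cast_nonneg _) hM
  have hc0 : 0 < c := by linarith
  rcases A.eq_empty_or_nonempty with rfl | hA
  · have : opn G ∅ = 0 := by simp [opn]
    rw [this, Nat.cast_zero]
    positivity
  rw [opn_eq]
  push_cast
  have hcard : Fintype.card ((A : Set V) : Type) = A.card := by simp
  have := hext s (by omega) (A : Set V) (G.induce (A : Set V)) (by
    rw [hcard]; exact hA.card_pos) (by
    rintro ⟨f, hf⟩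
    refine h1 ⟨⟨fun x => (f x).1, fun h => f.map_rel h⟩, ?_⟩
    intro x y hxy
    exact hf (Subtype.ext hxy)) (by
    rintro ⟨t, ⟨f⟩⟩
    refine h2 ⟨Subtype.val '' t, ⟨?_⟩⟩
    refine SimpleGraph.Iso.comp f (SimpleGraph.Iso.symm ?_)
    refine ⟨Equiv.Set.image _ t Subtype.val_injective, ?_⟩
    intro a b
    simp)
  rw [hcard] at this
  have h3 : (A.card : ℝ) ^ ((2 : ℝ) - ε) ≤ M ^ ((2 : ℝ) - ε) :=
    Real.rpow_le_rpow (by positivity) hM (by linarith)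
  have h5 : c * (s : ℝ) ^ 4 * (A.card : ℝ) ^ ((2 : ℝ) - ε) ≤ c * (s : ℝ) ^ 4 * M ^ ((2 : ℝ) - ε) := by
    gcongr
  exact mul_le_mul_of_nonneg_left (this.trans h5) (by norm_num)

open Classical in
theorem weight_sum {V : Type} [Fintype V] (p : ℝ) (T : Finset V) :
    ∑ S : Finset V, p ^ S.card * (1 - p) ^ (Sᶜ).card * (if T ⊆ S then 1 else 0) = p ^ T.card := by
  have h := Finset.prod_add (fun _ : V => p) (fun i : V => if i ∈ T then 0 else 1 - p) Finset.univ
  have h2 : ∏ i : V, (p + (if i ∈ T then 0 else 1 - p)) = p ^ T.card := by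
    have : ∀ i : V, (p + (if i ∈ T then 0 else 1 - p)) = if i ∈ T then p else 1 := by
      intro i; split_ifs <;> ring
    simp_rw [this]
    rw [Finset.prod_ite_mem]
    simp
  rw [← h2, h, Finset.powerset_univ]
  refine Finset.sum_congr rfl fun S _ => ?_
  rw [Finset.prod_const, mul_assoc]
  congr 1
  rw [← Finset.compl_eq_univ_sdiff]
  split_ifs with hT
  · rw [mul_one, Finset.prod_congr rfl (g := fun _ => 1 - p), Finset.prod_const]
    intro i hi
    rw [if_neg]
    intro hiT
    exact (Finset.mem_compl.1 hi) (hT hiT)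
  · obtain ⟨i, hi, hi'⟩ := Finset.not_subset.1 hT
    rw [mul_zero, eq_comm]
    exact Finset.prod_eq_zero (Finset.mem_compl.2 hi') (if_pos hi)

open Classical in
theorem weight_count {V ι : Type} [Fintype V] (p : ℝ) (I : Finset ι) (T : ι → Finset V) :
    ∑ S : Finset V, p ^ S.card * (1 - p) ^ (Sᶜ).card * ((I.filter (fun i => T i ⊆ S)).card : ℝ)
      = ∑ i ∈ I, p ^ (T i).card := by
  simp_rw [← weight_sum p (T _)]
  rw [Finset.sum_comm]
  refine Finset.sum_congr rfl fun S _ => ?_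
  rw [← Finset.mul_sum, Finset.card_filter]
  push_cast
  rfl

open Classical in
theorem pendant_bound {V ι : Type} [Fintype V] (G : SimpleGraph V) (p D : ℝ) (hp : 0 < p)
    (hpD : 1 ≤ p * D) (hD : ∀ v : V, ((G.neighborSet v).ncard : ℝ) ≤ D)
    (J : Finset ι) (r : ι → V) (T : ι → Finset V) (k : ℕ) (hk : ∀ j ∈ J, (T j).card = k) :
    ∑ i ∈ (J ×ˢ (Finset.univ : Finset V)).filter (fun x => G.Adj (r x.1) x.2),
      p ^ (insert i.2 (T i.1)).card ≤ J.card * ((k + 1) * D * p ^ (k + 1)) := by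
  rw [Finset.sum_filter, Finset.sum_product, ← nsmul_eq_mul]
  refine Finset.sum_le_card_nsmul _ _ _ fun j hj => ?_
  have hD0 : 0 ≤ D := le_trans (Nat.cast_nonneg _) (hD (r j))
  have hb : ∀ v : V, (if G.Adj (r j) v then p ^ (insert v (T j)).card else 0) ≤
      (if v ∈ T j then p ^ k else 0) + (if G.Adj (r j) v then p ^ (k + 1) else 0) := by
    intro v
    have := hk j hj
    by_cases hv : v ∈ T j
    · rw [Finset.insert_eq_of_mem hv, this]
      split_ifs <;> simp <;> positivity
    · rw [Finset.card_insert_of_notMem hv, this]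
      split_ifs <;> simp
  refine (Finset.sum_le_sum fun v _ => hb v).trans ?_
  rw [Finset.sum_add_distrib, ← Finset.sum_filter, ← Finset.sum_filter, Finset.sum_const,
    Finset.sum_const, nsmul_eq_mul, nsmul_eq_mul]
  have e1 : (Finset.univ.filter (fun v => v ∈ T j)).card = k := by
    rw [← hk j hj]; congr 1; ext; simp
  have e2 : ((Finset.univ.filter (fun v => G.Adj (r j) v)).card : ℝ) ≤ D := by
    refine le_trans (le_of_eq ?_) (hD (r j))
    rw [← Set.ncard_coe_finset]
    congr 2
    ext; simp
  rw [e1]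
  have h3 : (k : ℝ) * p ^ k ≤ k * (D * p ^ (k + 1)) := by
    have : p ^ k * 1 ≤ p ^ k * (p * D) := by gcongr
    have e : D * p ^ (k + 1) = p ^ k * (p * D) := by ring
    rw [e]
    gcongr
    linarith
  have h4 : ((Finset.univ.filter (fun v => G.Adj (r j) v)).card : ℝ) * p ^ (k + 1)
      ≤ D * p ^ (k + 1) := by gcongr
  linarith

theorem girth5 {W : Type} (G : SimpleGraph W)
    (h3 : ∀ u a b, G.Adj u a → G.Adj a b → G.Adj b u → False)
    (h4 : ∀ u a b c, G.Adj u a → G.Adj a b → G.Adj b c → G.Adj c u → u ≠ b → a ≠ c → False) :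
    (5 : ℕ∞) ≤ G.egirth := by
  rw [SimpleGraph.le_egirth]
  intro u w hw
  have hl := hw.three_le_length
  by_contra hlt
  have hlt' : w.length < 5 := by
    rw [not_le] at hlt
    exact_mod_cast hlt
  have hnd := hw.support_nodup
  match w, hl, hlt', hnd with
  | .cons ha (.cons hb (.cons hc .nil)), _, _, _ => exact h3 _ _ _ ha hb hc
  | .cons ha (.cons hb (.cons hc (.cons hd .nil))), _, _, hnd =>
    refine h4 _ _ _ _ ha hb hc hd ?_ ?_
    · rintro rfl
      simp at hnd
    · rintro rfl
      simp at hnd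
  | .cons ha (.cons hb (.cons hc (.cons hd (.cons he w)))), _, hlt, _ =>
    simp at hlt
    omega

open Classical in
/-- ordered triangles -/
noncomputable def J3 {V : Type} [Fintype V] (G : SimpleGraph V) : Finset (V × V × V) :=
  Finset.univ.filter (fun x => G.Adj x.1 x.2.1 ∧ G.Adj x.2.1 x.2.2 ∧ G.Adj x.2.2 x.1)

open Classical in
/-- ordered 4-cycles -/
noncomputable def J4 {V : Type} [Fintype V] (G : SimpleGraph V) : Finset ((V × V) × (V × V)) :=
  Finset.univ.filter (fun x => G.Adj x.1.1 x.1.2 ∧ G.Adj x.1.2 x.2.1 ∧ G.Adj x.2.1 x.2.2 ∧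
    G.Adj x.2.2 x.1.1 ∧ x.1.1 ≠ x.2.1 ∧ x.1.2 ≠ x.2.2)

open Classical in
/-- vertex set of an ordered triangle -/
noncomputable def T3 {V : Type} (x : V × V × V) : Finset V := {x.1, x.2.1, x.2.2}

open Classical in
/-- vertex set of an ordered 4-cycle -/
noncomputable def T4 {V : Type} (x : (V × V) × (V × V)) : Finset V :=
  {x.1.1, x.1.2, x.2.1, x.2.2}

open Classical in
/-- structures with a pendant edge -/
noncomputable def Pend {V ι : Type} [Fintype V] (G : SimpleGraph V) (J : Finset ι) (r : ι → V) :
    Finset (ι × V) :=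
  (J ×ˢ (Finset.univ : Finset V)).filter (fun x => G.Adj (r x.1) x.2)

theorem T3_card {V : Type} [Fintype V] (G : SimpleGraph V) : ∀ j ∈ J3 G, (T3 j).card = 3 := by
  classical
  rintro ⟨u, a, b⟩ h
  simp only [J3, Finset.mem_filter, Finset.mem_univ, true_and] at h
  exact Finset.card_eq_three.2 ⟨u, a, b, h.1.ne, h.2.2.ne', h.2.1.ne, by simp [T3]⟩

theorem T4_card {V : Type} [Fintype V] (G : SimpleGraph V) : ∀ j ∈ J4 G, (T4 j).card = 4 := by
  classical
  rintro ⟨⟨u, a⟩, b, d⟩ h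
  simp only [J4, Finset.mem_filter, Finset.mem_univ, true_and] at h
  obtain ⟨h1, h2, h3, h4, h5, h6⟩ := h
  simp only [T4]
  rw [Finset.card_insert_of_notMem, Finset.card_eq_three.2 ⟨a, b, d, h2.ne, h6, h3.ne, rfl⟩]
  simp [h1.ne, h5, h4.ne']

theorem nbr_card {V : Type} [Fintype V] (G : SimpleGraph V) [DecidableRel G.Adj] (v : V) :
    (G.neighborFinset v).card = (G.neighborSet v).ncard := by
  rw [← Set.ncard_coe_finset, SimpleGraph.coe_neighborFinset]

theorem J3_card {V : Type} [Fintype V] (G : SimpleGraph V) (D K : ℝ)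
    (hD : ∀ v : V, ((G.neighborSet v).ncard : ℝ) ≤ D)
    (hK : ∀ A : Finset V, (A.card : ℝ) ≤ D → (opn G A : ℝ) ≤ K) :
    ((J3 G).card : ℝ) ≤ Fintype.card V * K := by
  classical
  have e : (J3 G).card = ∑ u : V, opn G (G.neighborFinset u) := by
    unfold J3 opn
    rw [Finset.card_filter, Fintype.sum_prod_type]
    refine Finset.sum_congr rfl fun u _ => ?_
    rw [Finset.card_filter]
    refine Finset.sum_congr rfl fun x _ => ?_
    congr 1
    simp only [SimpleGraph.mem_neighborFinset, G.adj_comm u]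
    apply propext
    tauto
  rw [e]
  push_cast
  rw [← nsmul_eq_mul]
  exact Finset.sum_le_card_nsmul _ _ _ fun u _ => hK _ (by rw [nbr_card]; exact hD u)

theorem J4_card {V : Type} [Fintype V] (G : SimpleGraph V) (D K : ℝ) (hK0 : 0 ≤ K)
    (hD : ∀ v : V, ((G.neighborSet v).ncard : ℝ) ≤ D)
    (hK : ∀ A : Finset V, (A.card : ℝ) ≤ 2 * D → (opn G A : ℝ) ≤ K) :
    ((J4 G).card : ℝ) ≤ Fintype.card V * D * K := by
  classical
  have e : ((J4 G).card : ℝ) ≤ ∑ x : V × V, if G.Adj x.1 x.2 then K else 0 := by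
    unfold J4
    rw [Finset.card_filter, Fintype.sum_prod_type]
    push_cast
    refine Finset.sum_le_sum fun x _ => ?_
    split_ifs with hx
    · refine le_trans ?_ (hK (G.neighborFinset x.1 ∪ G.neighborFinset x.2) ?_)
      · unfold opn
        rw [Finset.card_filter]
        push_cast
        refine Finset.sum_le_sum fun y _ => ?_
        split_ifs with h1 h2 h2
        · rfl
        · exfalso
          apply h2
          obtain ⟨h1, h2, h3, h4, -⟩ := h1
          simp [h2, h3, h4.symm]
        · norm_num
        · rfl
      · have := Finset.card_union_le (G.neighborFinset x.1) (G.neighborFinset x.2)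
        rw [nbr_card, nbr_card] at this
        have h' : ((G.neighborFinset x.1 ∪ G.neighborFinset x.2).card : ℝ) ≤
          (G.neighborSet x.1).ncard + (G.neighborSet x.2).ncard := by exact_mod_cast this
        linarith [hD x.1, hD x.2]
    · apply le_of_eq
      apply Finset.sum_eq_zero
      intro y _
      rw [if_neg]
      exact fun h => hx h.1
  refine e.trans ?_
  rw [Fintype.sum_prod_type, mul_assoc, ← nsmul_eq_mul]
  refine Finset.sum_le_card_nsmul _ _ _ fun u _ => ?_
  rw [← Finset.sum_filter, Finset.sum_const, nsmul_eq_mul]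
  refine mul_le_mul_of_nonneg_right ?_ hK0
  refine le_trans (le_of_eq ?_) (hD u)
  rw [← nbr_card]
  congr 2
  ext; simp

open Classical in
theorem cleanup {V : Type} [Fintype V] (G : SimpleGraph V) (S : Finset V) :
    ∃ t ⊆ S, (5 : ℕ∞) ≤ (G.induce (t : Set V)).egirth ∧
      opn G S ≤ opn G t
        + 2 * ((Pend G (J3 G) (fun x => x.1)).filter (fun i => insert i.2 (T3 i.1) ⊆ S)).card
        + 2 * ((Pend G (J4 G) (fun x => x.1.1)).filter (fun i => insert i.2 (T4 i.1) ⊆ S)).card := by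
  let bad : V → Prop := fun u => (∃ j ∈ J3 G, j.1 = u ∧ T3 j ⊆ S) ∨
    (∃ j ∈ J4 G, j.1.1 = u ∧ T4 j ⊆ S)
  refine ⟨S.filter (fun u => ¬ bad u), Finset.filter_subset _ _, ?_, ?_⟩
  · apply girth5
    · rintro ⟨u, hu⟩ ⟨a, ha⟩ ⟨b, hb⟩ h1 h2 h3
      simp only [Finset.coe_filter, Set.mem_ofPred_eq, SimpleGraph.comap_adj,
        Function.Embedding.subtype_apply] at hu ha hb h1 h2 h3
      apply hu.2
      left
      refine ⟨(u, a, b), ?_, rfl, ?_⟩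
      · simp [J3, h1, h2, h3]
      · simp [T3, Finset.insert_subset_iff, hu.1, ha.1, hb.1]
    · rintro ⟨u, hu⟩ ⟨a, ha⟩ ⟨b, hb⟩ ⟨d, hd⟩ h1 h2 h3 h4 h5 h6
      simp only [Finset.coe_filter, Set.mem_ofPred_eq, SimpleGraph.comap_adj,
        Function.Embedding.subtype_apply, ne_eq, Subtype.mk.injEq] at hu ha hb hd h1 h2 h3 h4 h5 h6
      apply hu.2
      right
      refine ⟨((u, a), (b, d)), ?_, rfl, ?_⟩
      · simp [J4, h1, h2, h3, h4, h5, h6]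
      · simp [T4, Finset.insert_subset_iff, hu.1, ha.1, hb.1, hd.1]
  · set t := S.filter (fun u => ¬ bad u) with ht
    set X3 := (Pend G (J3 G) (fun x => x.1)).filter (fun i => insert i.2 (T3 i.1) ⊆ S) with hX3
    set X4 := (Pend G (J4 G) (fun x => x.1.1)).filter (fun i => insert i.2 (T4 i.1) ⊆ S) with hX4
    let B : Finset (V × V) := X3.image (fun i => (i.1.1, i.2)) ∪ X4.image (fun i => (i.1.1.1, i.2))
    have hB : B.card ≤ X3.card + X4.card :=
      (Finset.card_union_le _ _).trans (add_le_add Finset.card_image_le Finset.card_image_le)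
    have key : ∀ x y, G.Adj x y → y ∈ S → bad x → (x, y) ∈ B := by
      intro x y hxy hy hx
      rcases hx with ⟨j, hj, rfl, hjS⟩ | ⟨j, hj, rfl, hjS⟩
      · refine Finset.mem_union_left _ (Finset.mem_image.2 ⟨(j, y), ?_, rfl⟩)
        simp only [hX3, Pend, Finset.mem_filter, Finset.mem_product, Finset.mem_univ, and_true]
        exact ⟨⟨hj, hxy⟩, Finset.insert_subset hy hjS⟩
      · refine Finset.mem_union_right _ (Finset.mem_image.2 ⟨(j, y), ?_, rfl⟩)
        simp only [hX4, Pend, Finset.mem_filter, Finset.mem_product, Finset.mem_univ, and_true]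
        exact ⟨⟨hj, hxy⟩, Finset.insert_subset hy hjS⟩
    have hsub : (Finset.univ : Finset (V × V)).filter
        (fun x => G.Adj x.1 x.2 ∧ x.1 ∈ S ∧ x.2 ∈ S) ⊆
        (Finset.univ.filter (fun x : V × V => G.Adj x.1 x.2 ∧ x.1 ∈ t ∧ x.2 ∈ t) ∪ B) ∪
          B.image Prod.swap := by
      rintro ⟨x, y⟩ h
      simp only [Finset.mem_filter, Finset.mem_univ, true_and] at h
      obtain ⟨h1, h2, h3⟩ := h
      by_cases hx : bad x
      · exact Finset.mem_union_left _ (Finset.mem_union_right _ (key x y h1 h3 hx))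
      by_cases hy : bad y
      · exact Finset.mem_union_right _ (Finset.mem_image.2 ⟨(y, x), key y x h1.symm h2 hy, rfl⟩)
      · refine Finset.mem_union_left _ (Finset.mem_union_left _ ?_)
        simp [ht, h1, h2, h3, hx, hy]
    have h1 := Finset.card_le_card hsub
    have h2 := Finset.card_union_le (Finset.univ.filter (fun x : V × V =>
      G.Adj x.1 x.2 ∧ x.1 ∈ t ∧ x.2 ∈ t) ∪ B) (B.image Prod.swap)
    have h3 := Finset.card_union_le (Finset.univ.filter (fun x : V × V =>
      G.Adj x.1 x.2 ∧ x.1 ∈ t ∧ x.2 ∈ t)) B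
    have h4 : (B.image Prod.swap).card ≤ B.card := Finset.card_image_le
    change _ ≤ opn G t + _ at h3
    change opn G S ≤ _ at h1
    omega

theorem core_s9 {V : Type} [Fintype V] (G : SimpleGraph V) (p D m : ℝ) (hp : 0 < p) (hp1 : p ≤ 1)
    (hpD : 1 ≤ p * D) (hm : 0 ≤ m) (hD : ∀ v : V, ((G.neighborSet v).ncard : ℝ) ≤ D)
    (hpos : 0 < p ^ 2 * (opn G Finset.univ : ℝ) - 2 * ((J3 G).card * (4 * D * p ^ 4))
      - 2 * ((J4 G).card * (5 * D * p ^ 5)) - m * (p * Fintype.card V)) :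
    ∃ t : Finset V, (5 : ℕ∞) ≤ (G.induce (t : Set V)).egirth ∧
      m ≤ avgDeg (G.induce (t : Set V)) := by
  classical
  let w : Finset V → ℝ := fun S => p ^ S.card * (1 - p) ^ (Sᶜ).card
  have hw : ∀ S, 0 ≤ w S := fun S =>
    mul_nonneg (pow_nonneg hp.le _) (pow_nonneg (by linarith) _)
  let X3 : Finset V → ℕ := fun S =>
    ((Pend G (J3 G) (fun x => x.1)).filter (fun i => insert i.2 (T3 i.1) ⊆ S)).card
  let X4 : Finset V → ℕ := fun S =>
    ((Pend G (J4 G) (fun x => x.1.1)).filter (fun i => insert i.2 (T4 i.1) ⊆ S)).card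
  have E1 : ∑ S : Finset V, w S * (opn G S : ℝ) = p ^ 2 * (opn G Finset.univ : ℝ) := by
    have h := weight_count p (Finset.univ.filter (fun x : V × V => G.Adj x.1 x.2))
      (fun x => {x.1, x.2})
    rw [Finset.sum_congr (s₁ := Finset.univ.filter (fun x : V × V => G.Adj x.1 x.2)) rfl
      (g := fun _ => p ^ 2), Finset.sum_const, nsmul_eq_mul] at h
    · have e1 : ((Finset.univ.filter (fun x : V × V => G.Adj x.1 x.2)).card : ℝ)
          = opn G Finset.univ := by simp [opn]
      rw [e1, mul_comm] at h
      rw [← h]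
      refine Finset.sum_congr rfl fun S _ => ?_
      congr 2
      unfold opn
      rw [Finset.filter_filter]
      congr 1
      ext x
      simp [Finset.insert_subset_iff]
    · rintro ⟨x, y⟩ h
      simp at h
      rw [Finset.card_pair h.ne]
  have E2 : ∑ S : Finset V, w S * (S.card : ℝ) = p * Fintype.card V := by
    have h := weight_count p (Finset.univ : Finset V) (fun x => {x})
    simp at h
    rw [mul_comm, ← h]
  have E3 : ∑ S : Finset V, w S * (X3 S : ℝ) ≤ (J3 G).card * (4 * D * p ^ 4) := by
    have h := pendant_bound G p D hp hpD hD (J3 G) (fun x => x.1) T3 3 (T3_card G)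
    norm_num at h
    refine le_trans (le_of_eq ?_) h
    exact weight_count p (Pend G (J3 G) (fun x => x.1)) (fun i => insert i.2 (T3 i.1))
  have E4 : ∑ S : Finset V, w S * (X4 S : ℝ) ≤ (J4 G).card * (5 * D * p ^ 5) := by
    have h := pendant_bound G p D hp hpD hD (J4 G) (fun x => x.1.1) T4 4 (T4_card G)
    norm_num at h
    refine le_trans (le_of_eq ?_) h
    exact weight_count p (Pend G (J4 G) (fun x => x.1.1)) (fun i => insert i.2 (T4 i.1))
  have hS : ∃ S : Finset V, 0 < (opn G S : ℝ) - 2 * X3 S - 2 * X4 S - m * S.card := by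
    by_contra hcon
    push Not at hcon
    have h1 : ∑ S : Finset V, w S * ((opn G S : ℝ) - 2 * X3 S - 2 * X4 S - m * S.card) ≤ 0 :=
      Finset.sum_nonpos fun S _ => mul_nonpos_of_nonneg_of_nonpos (hw S) (hcon S)
    have h2 : ∑ S : Finset V, w S * ((opn G S : ℝ) - 2 * X3 S - 2 * X4 S - m * S.card) =
        ∑ S : Finset V, w S * (opn G S : ℝ) - 2 * ∑ S : Finset V, w S * (X3 S : ℝ)
          - 2 * ∑ S : Finset V, w S * (X4 S : ℝ) - m * ∑ S : Finset V, w S * (S.card : ℝ) := by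
      rw [Finset.mul_sum, Finset.mul_sum, Finset.mul_sum, ← Finset.sum_sub_distrib,
        ← Finset.sum_sub_distrib, ← Finset.sum_sub_distrib]
      refine Finset.sum_congr rfl fun S _ => ?_
      ring
    rw [h2, E1, E2] at h1
    linarith
  obtain ⟨S, hS⟩ := hS
  obtain ⟨t, htS, hg, hle⟩ := cleanup G S
  refine ⟨t, hg, ?_⟩
  have hle' : (opn G S : ℝ) ≤ opn G t + 2 * X3 S + 2 * X4 S := by exact_mod_cast hle
  have hc : (t.card : ℝ) ≤ S.card := by exact_mod_cast Finset.card_le_card htS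
  have hc' : m * t.card ≤ m * S.card := by gcongr
  have hfin : m * t.card < opn G t := by linarith
  have ht0 : 0 < t.card := by
    rcases t.eq_empty_or_nonempty with rfl | h
    · simp [opn] at hfin
    · exact h.card_pos
  have hc2 : Fintype.card ((t : Set V) : Type) = t.card := by simp
  unfold avgDeg
  have e := opn_eq G t
  have e' : (2 * ((G.induce (t : Set V)).edgeSet.ncard : ℝ)) = opn G t := by
    rw [e]; push_cast; rfl
  have hc3 : (Fintype.card ((t : Set V) : Type) : ℝ) = t.card := by exact_mod_cast hc2
  rw [e', le_div_iff₀]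
  · convert hfin.le using 2
  · have : 0 < (t.card : ℝ) := by exact_mod_cast ht0
    rw [← hc3] at this
    convert this

theorem avg_univ {V : Type} [Fintype V] (G : SimpleGraph V) :
    (opn G Finset.univ : ℝ) = 2 * G.edgeSet.ncard := by
  classical
  have := pairs_eq G
  have e : opn G Finset.univ = 2 * G.edgeSet.ncard := by
    rw [← this]
    simp [opn]
  rw [e]
  push_cast
  rfl

/-- Under the extremal hypothesis for a bipartite `H` with constants `ε, c`,
there is a polynomial `P` such that for every `s ≥ 2` and `Δ ≥ P(s)`, every
`K_{s,s}`-subgraph-free graph with no induced copy of `H`, maximum degree at most `Δ` and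
average degree at least `Δ^(1-ε/10)` has an induced subgraph of girth at least five with
average degree at least `(1/2)·Δ^(ε/10)`. -/
theorem stmt_9 {VH : Type} [Fintype VH] (H : SimpleGraph VH) (hH : H.Colorable 2)
    (ε c : ℝ) (hε : 0 < ε) (hε2 : ε ≤ 1 / 2) (hc : 1 < c) (hext : ExtremalBound H ε c) :
    ∃ P : Polynomial ℝ, ∀ s : ℕ, 2 ≤ s → ∀ Δ : ℝ, P.eval (s : ℝ) ≤ Δ →
      ∀ (V : Type) [Fintype V], ∀ G : SimpleGraph V,
        ¬ HasSubgraphCopy G (completeBipartiteGraph (Fin s) (Fin s)) →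
        ¬ HasInducedCopy G H →
        (∀ v : V, ((G.neighborSet v).ncard : ℝ) ≤ Δ) →
        Δ ^ ((1 : ℝ) - ε / 10) ≤ avgDeg G →
        ∃ t : Finset V, (5 : ℕ∞) ≤ (G.induce (t : Set V)).egirth ∧
          1 / 2 * Δ ^ (ε / 10) ≤ avgDeg (G.induce (t : Set V)) := by
  obtain ⟨k, hk⟩ := exists_nat_ge (10 / (3 * ε))
  refine ⟨(Polynomial.C (193 * c) * Polynomial.X ^ 4) ^ k, ?_⟩
  intro s hs D hPD V _ G h1 h2 hD havg
  simp only [Polynomial.eval_pow, Polynomial.eval_mul, Polynomial.eval_C, Polynomial.eval_X]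
    at hPD
  have hs1 : (1 : ℝ) ≤ s := by exact_mod_cast (by omega : 1 ≤ s)
  have hs4 : (1 : ℝ) ≤ (s : ℝ) ^ 4 := one_le_pow₀ hs1
  set L : ℝ := c * (s : ℝ) ^ 4 with hL
  have hL1 : 1 ≤ L := by nlinarith
  have hLe : 193 * c * (s : ℝ) ^ 4 = 193 * L := by rw [hL]; ring
  rw [hLe] at hPD
  have hD1 : 1 ≤ D := le_trans (one_le_pow₀ (by linarith)) hPD
  have hD0 : 0 < D := by linarith
  have hY : 193 * L ≤ D ^ (3 * ε / 10) := by
    have hkk : 1 ≤ (k : ℝ) * (3 * ε / 10) := by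
      rw [div_le_iff₀ (by positivity)] at hk
      linarith
    calc 193 * L = (193 * L) ^ (1 : ℝ) := (Real.rpow_one _).symm
      _ ≤ (193 * L) ^ ((k : ℝ) * (3 * ε / 10)) :=
        Real.rpow_le_rpow_of_exponent_le (by linarith) hkk
      _ = ((193 * L) ^ k) ^ (3 * ε / 10) := by
        rw [Real.rpow_mul (by linarith), Real.rpow_natCast]
      _ ≤ D ^ (3 * ε / 10) := Real.rpow_le_rpow (by positivity) hPD (by positivity)
  have hn : 0 < (Fintype.card V : ℝ) := by
    rcases Nat.eq_zero_or_pos (Fintype.card V) with h | h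
    · exfalso
      have : 0 < D ^ ((1 : ℝ) - ε / 10) := Real.rpow_pos_of_pos hD0 _
      unfold avgDeg at havg
      rw [h] at havg
      simp at havg
      linarith
    · exact_mod_cast h
  unfold avgDeg at havg
  rw [le_div_iff₀ hn, ← avg_univ] at havg
  set n : ℝ := (Fintype.card V : ℝ) with hnn
  set p : ℝ := D ^ (-1 + ε / 5) with hpdef
  have hp : 0 < p := Real.rpow_pos_of_pos hD0 _
  have powp : ∀ j : ℕ, p ^ j = D ^ ((-1 + ε / 5) * j) := by
    intro j
    rw [Real.rpow_mul hD0.le, Real.rpow_natCast]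
  have hK3 : ∀ A : Finset V, (A.card : ℝ) ≤ D → (opn G A : ℝ) ≤ 2 * (L * D ^ (2 - ε)) :=
    fun A hA => opn_le hε2 hc hext hs h1 h2 A D hA
  have hK4 : ∀ A : Finset V, (A.card : ℝ) ≤ 2 * D → (opn G A : ℝ) ≤ 8 * (L * D ^ (2 - ε)) := by
    intro A hA
    have h := opn_le hε2 hc hext hs h1 h2 A (2 * D) hA
    refine h.trans ?_
    rw [← hL, Real.mul_rpow (by norm_num) hD0.le]
    have h22 : (2 : ℝ) ^ (2 - ε) ≤ 4 := by
      calc (2 : ℝ) ^ (2 - ε) ≤ 2 ^ (2 : ℝ) :=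
            Real.rpow_le_rpow_of_exponent_le (by norm_num) (by linarith)
        _ = 4 := by norm_num
    have h23 : 0 ≤ L * D ^ (2 - ε) := by positivity
    nlinarith
  have hJ3 := J3_card G D _ hD hK3
  have hJ4 := J4_card G D _ (by positivity) hD hK4
  rw [← hnn] at hJ3 hJ4
  refine core_s9 G p D _ hp ?_ ?_ (by positivity) hD ?_
  · exact Real.rpow_le_one_of_one_le_of_nonpos hD1 (by linarith)
  · have : p * D = D ^ (ε / 5) := by
      rw [hpdef, ← Real.rpow_add_one hD0.ne']
      congr 1; ring
    rw [this]
    exact Real.one_le_rpow hD1 (by positivity)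
  · have B1 : n * (D ^ (-1 : ℝ) * D ^ (3 * ε / 10)) ≤ p ^ 2 * (opn G Finset.univ : ℝ) := by
      have : n * (D ^ (-1 : ℝ) * D ^ (3 * ε / 10)) = p ^ 2 * (D ^ ((1 : ℝ) - ε / 10) * n) := by
        rw [powp, ← mul_assoc (D ^ _), ← Real.rpow_add hD0, ← Real.rpow_add hD0, mul_comm]
        congr 2; push_cast; ring
      rw [this]
      gcongr
    have B2 : 1 / 2 * D ^ (ε / 10) * (p * n) = 1 / 2 * (n * (D ^ (-1 : ℝ) * D ^ (3 * ε / 10))) := by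
      have : D ^ (-1 : ℝ) * D ^ (3 * ε / 10) = D ^ (ε / 10) * p := by
        rw [hpdef, ← Real.rpow_add hD0, ← Real.rpow_add hD0]
        congr 1; ring
      rw [this]; ring
    have B3 : (J3 G).card * (4 * D * p ^ 4) ≤ 8 * L * (n * D ^ (-1 : ℝ)) := by
      have e : D ^ (2 - ε) * (D * p ^ 4) ≤ D ^ (-1 : ℝ) := by
        rw [powp, ← Real.rpow_one_add' hD0.le, ← Real.rpow_add hD0]
        · apply Real.rpow_le_rpow_of_exponent_le hD1
          push_cast; linarith
        · push_cast; linarith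
      calc (J3 G).card * (4 * D * p ^ 4) ≤ n * (2 * (L * D ^ (2 - ε))) * (4 * D * p ^ 4) := by
            gcongr
        _ = 8 * L * (n * (D ^ (2 - ε) * (D * p ^ 4))) := by ring
        _ ≤ _ := by gcongr
    have B4 : (J4 G).card * (5 * D * p ^ 5) ≤ 40 * L * (n * D ^ (-1 : ℝ)) := by
      have e : D * D ^ (2 - ε) * (D * p ^ 5) ≤ D ^ (-1 : ℝ) := by
        rw [powp, ← Real.rpow_one_add' hD0.le, ← Real.rpow_one_add' hD0.le, ← Real.rpow_add hD0]
        · apply Real.rpow_le_rpow_of_exponent_le hD1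
          push_cast; linarith
        · push_cast; linarith
        · linarith
      calc (J4 G).card * (5 * D * p ^ 5) ≤ n * D * (8 * (L * D ^ (2 - ε))) * (5 * D * p ^ 5) := by
            gcongr
        _ = 40 * L * (n * (D * D ^ (2 - ε) * (D * p ^ 5))) := by ring
        _ ≤ _ := by gcongr
    have hq : 0 < n * D ^ (-1 : ℝ) := by positivity
    rw [B2]
    have B5 : 193 * L * (n * D ^ (-1 : ℝ)) ≤ n * (D ^ (-1 : ℝ) * D ^ (3 * ε / 10)) := by
      calc 193 * L * (n * D ^ (-1 : ℝ)) ≤ D ^ (3 * ε / 10) * (n * D ^ (-1 : ℝ)) := by gcongr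
        _ = _ := by ring
    have hLq : 0 < L * (n * D ^ (-1 : ℝ)) := by positivity
    linarith
end
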